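/- arXiv:1903.12292 — 9 statements merged into one kernel-verified Lean document; each statement's English description precedes it below -/
import Mathlib

section
/- (O'Rourke) If G is a maximal outerplanar graph of order n ≥ 10, then G has a diagonal d that partitions G into two maximal outerplanar graphs G₁ and G₂ (i.e., G is the union of G₁ and G₂, V(G₁) ∩ V(G₂) consists of the two endpoints of d, and E(G₁) ∩ E(G₂) = {d}) such that G₁ contains exactly 5, 6, 7 or 8 Hamiltonian edges of G. -/
open SimpleGraph

/-- Inductive definition of a maximal outerplanar graph together with its
Hamiltonian cycle (given as the finite set of cycle edges), with vertex set
a finite subset of `ℕ`. The triangle is a mop; and a mop grows by adding a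
new vertex `w` joined exactly to the two endpoints of a Hamiltonian edge
`s(u, v)`, the cycle being updated by replacing `s(u, v)` with
`s(u, w)` and `s(v, w)`. -/
inductive IsMopCycle : SimpleGraph ℕ → Finset ℕ → Finset (Sym2 ℕ) → Prop
  | triangle (a b c : ℕ) (hab : a ≠ b) (hac : a ≠ c) (hbc : b ≠ c) :
      IsMopCycle (SimpleGraph.fromEdgeSet {s(a, b), s(b, c), s(a, c)})
        {a, b, c} {s(a, b), s(b, c), s(a, c)}
  | grow (G : SimpleGraph ℕ) (V : Finset ℕ) (C : Finset (Sym2 ℕ)) (u v w : ℕ)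
      (hG : IsMopCycle G V C) (huv : s(u, v) ∈ C) (hw : w ∉ V) :
      IsMopCycle (SimpleGraph.fromEdgeSet (insert s(u, w) (insert s(v, w) G.edgeSet)))
        (insert w V) (insert s(u, w) (insert s(v, w) (C.erase s(u, v))))

/-- `G` is a maximal outerplanar graph with vertex set `V`. -/
def IsMop (G : SimpleGraph ℕ) (V : Finset ℕ) : Prop := ∃ C, IsMopCycle G V C

/-- The closed neighborhood `N[S]` of a set of vertices `S` in `G`. -/
def closedNbhd (G : SimpleGraph ℕ) (S : Finset ℕ) : Set ℕ :=
  {v | v ∈ S ∨ ∃ u ∈ S, G.Adj u v}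

/-- `S` is a `K_{1,2}`-isolating set of the graph `G` with vertex set `V`:
`S ⊆ V` and `G − N[S]` contains no copy of the star `K_{1,2}`. -/
def IsIsolating12 (G : SimpleGraph ℕ) (V : Finset ℕ) (S : Finset ℕ) : Prop :=
  S ⊆ V ∧ ∀ x y z : ℕ, x ∈ V → y ∈ V → z ∈ V →
    x ∉ closedNbhd G S → y ∉ closedNbhd G S → z ∉ closedNbhd G S →
    G.Adj x y → G.Adj x z → y = z

/-- The `K_{1,2}`-isolation number `ι₁` of the graph `G` with vertex set `V`. -/
noncomputable def iota1 (G : SimpleGraph ℕ) (V : Finset ℕ) : ℕ :=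
  sInf {k | ∃ S : Finset ℕ, IsIsolating12 G V S ∧ S.card = k}

/-- The degree of a vertex. -/
noncomputable def degOf (G : SimpleGraph ℕ) (v : ℕ) : ℕ := (G.neighborSet v).ncard

/-- The number of vertices of degree 2. -/
noncomputable def numDeg2 (G : SimpleGraph ℕ) (V : Finset ℕ) : ℕ :=
  {v ∈ (V : Set ℕ) | degOf G v = 2}.ncard

/-- A triangulated polygon rooted at the base edge `s(x, y)`; `P` is the set of the boundary
edges other than the base (for the degenerate polygon, the base itself). -/
inductive RPoly : ℕ → ℕ → Set (Sym2 ℕ) → Finset ℕ → Finset (Sym2 ℕ) → Prop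
  | leaf (x y : ℕ) (hxy : x ≠ y) : RPoly x y {s(x, y)} {x, y} {s(x, y)}
  | node (x y z : ℕ) (E₁ E₂ : Set (Sym2 ℕ)) (V₁ V₂ : Finset ℕ) (P₁ P₂ : Finset (Sym2 ℕ))
      (h₁ : RPoly x z E₁ V₁ P₁) (h₂ : RPoly z y E₂ V₂ P₂)
      (hx : x ∉ V₂) (hy : y ∉ V₁) (hV : ∀ t, t ∈ V₁ → t ∈ V₂ → t = z) :
      RPoly x y (insert s(x, y) (E₁ ∪ E₂)) (V₁ ∪ V₂) (P₁ ∪ P₂)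

/-- `E` is the edge set of a mop with vertex set `V` and cycle `C`. -/
def MopE (E : Set (Sym2 ℕ)) (V : Finset ℕ) (C : Finset (Sym2 ℕ)) : Prop :=
  ∃ G : SimpleGraph ℕ, IsMopCycle G V C ∧ G.edgeSet = E

lemma RPoly.base_mem {x y E V P} (h : RPoly x y E V P) :
    x ∈ V ∧ y ∈ V ∧ x ≠ y ∧ s(x, y) ∈ E := by
  induction h with
  | leaf x y hxy => simp [hxy]
  | node x y z E₁ E₂ V₁ V₂ P₁ P₂ h₁ h₂ hx hy hV ih₁ ih₂ =>
    refine ⟨by simp [ih₁.1], by simp [ih₂.2.1], ?_, by simp⟩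
    rintro rfl
    exact hx ih₂.2.1

lemma RPoly.edge_mem {x y E V P} (h : RPoly x y E V P) :
    ∀ a b, s(a, b) ∈ E → a ∈ V ∧ b ∈ V ∧ a ≠ b := by
  have hb := h.base_mem
  induction h with
  | leaf x y hxy =>
    intro a b hab
    simp only [Set.mem_singleton_iff, Sym2.eq_iff] at hab
    grind
  | node x y z E₁ E₂ V₁ V₂ P₁ P₂ h₁ h₂ hx hy hV ih₁ ih₂ =>
    intro a b hab
    have := ih₁ h₁.base_mem a b
    have := ih₂ h₂.base_mem a b
    simp only [Set.mem_insert_iff, Set.mem_union, Sym2.eq_iff] at hab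
    grind

lemma RPoly.path_sub {x y E V P} (h : RPoly x y E V P) : ∀ e ∈ P, e ∈ E := by
  induction h with
  | leaf x y hxy => simp
  | node x y z E₁ E₂ V₁ V₂ P₁ P₂ h₁ h₂ hx hy hV ih₁ ih₂ =>
    intro e he
    simp only [Finset.mem_union, Set.mem_insert_iff, Set.mem_union] at *
    grind

lemma RPoly.node_not_mem {x y z E₁ E₂ V₁ V₂ P₁ P₂}
    (h₁ : RPoly x z E₁ V₁ P₁) (h₂ : RPoly z y E₂ V₂ P₂)
    (hx : x ∉ V₂) (hy : y ∉ V₁) : s(x, y) ∉ P₁ ∪ P₂ := by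
  intro he
  rcases Finset.mem_union.1 he with he | he
  · exact hy (h₁.edge_mem _ _ (h₁.path_sub _ he)).2.1
  · exact hx (h₂.edge_mem _ _ (h₂.path_sub _ he)).1

lemma RPoly.disj {x y z E₁ E₂ V₁ V₂ P₁ P₂}
    (h₁ : RPoly x z E₁ V₁ P₁) (h₂ : RPoly z y E₂ V₂ P₂)
    (hV : ∀ t, t ∈ V₁ → t ∈ V₂ → t = z) : Disjoint P₁ P₂ := by
  rw [Finset.disjoint_left]
  intro e he he'
  induction e using Sym2.ind with
  | _ a b =>
    have k₁ := h₁.edge_mem _ _ (h₁.path_sub _ he)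
    have k₂ := h₂.edge_mem _ _ (h₂.path_sub _ he')
    have := hV a k₁.1 k₂.1
    have := hV b k₁.2.1 k₂.2.1
    grind

lemma RPoly.card {x y E V P} (h : RPoly x y E V P) : V.card = P.card + 1 := by
  induction h with
  | leaf x y hxy => simp [hxy]
  | node x y z E₁ E₂ V₁ V₂ P₁ P₂ h₁ h₂ hx hy hV ih₁ ih₂ =>
    rw [Finset.card_union_of_disjoint (RPoly.disj h₁ h₂ hV)]
    have hi : V₁ ∩ V₂ = {z} := by
      ext t
      have := hV t
      have := h₁.base_mem
      have := h₂.base_mem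
      simp only [Finset.mem_inter, Finset.mem_singleton]
      grind
    have := Finset.card_union_add_card_inter V₁ V₂
    rw [hi, Finset.card_singleton] at this
    omega

lemma MopE.inv {E V C} (h : MopE E V C) :
    (∀ e ∈ C, e ∈ E) ∧ ∀ a b, s(a, b) ∈ E → a ∈ V ∧ b ∈ V ∧ a ≠ b := by
  obtain ⟨G, hG, rfl⟩ := h
  induction hG with
  | triangle a b c hab hac hbc =>
    constructor
    · intro e he
      induction e using Sym2.ind with
      | _ p q =>
      simp only [SimpleGraph.mem_edgeSet, SimpleGraph.fromEdgeSet_adj, Set.mem_insert_iff,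
        Set.mem_singleton_iff, Finset.mem_insert, Finset.mem_singleton, Sym2.eq_iff] at *
      grind
    · intro p q he
      simp only [SimpleGraph.mem_edgeSet, SimpleGraph.fromEdgeSet_adj, Set.mem_insert_iff,
        Set.mem_singleton_iff, Finset.mem_insert, Finset.mem_singleton, Sym2.eq_iff] at *
      grind
  | grow G V C u v w hG huv hw ih =>
    have key := ih.2 _ _ (ih.1 _ huv)
    constructor
    · intro e he
      induction e using Sym2.ind with
      | _ p q =>
      have h1 := ih.1 s(p, q)
      have h2 := ih.2 p q
      simp only [SimpleGraph.mem_edgeSet, SimpleGraph.fromEdgeSet_adj, Set.mem_insert_iff,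
        Finset.mem_insert, Finset.mem_erase, Sym2.eq_iff] at *
      grind
    · intro p q he
      have h2 := ih.2 p q
      simp only [SimpleGraph.mem_edgeSet, SimpleGraph.fromEdgeSet_adj, Set.mem_insert_iff,
        Finset.mem_insert, Sym2.eq_iff] at *
      grind

lemma MopE.grow {E V C} (h : MopE E V C) {u v w : ℕ} (huv : s(u, v) ∈ C) (hw : w ∉ V) :
    MopE (insert s(u, w) (insert s(v, w) E)) (insert w V)
      (insert s(u, w) (insert s(v, w) (C.erase s(u, v)))) := by
  have hi := h.inv
  have key := hi.2 _ _ (hi.1 _ huv)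
  obtain ⟨G, hG, rfl⟩ := h
  refine ⟨_, IsMopCycle.grow G V C u v w hG huv hw, ?_⟩
  ext e
  induction e using Sym2.ind with
  | _ p q =>
  have h2 := hi.2 p q
  simp only [SimpleGraph.mem_edgeSet, SimpleGraph.fromEdgeSet_adj, Set.mem_insert_iff,
    Sym2.eq_iff] at *
  grind

lemma MopE.triangle {a b c : ℕ} (hab : a ≠ b) (hac : a ≠ c) (hbc : b ≠ c) :
    MopE {s(a, b), s(b, c), s(a, c)} {a, b, c} {s(a, b), s(b, c), s(a, c)} := by
  refine ⟨_, IsMopCycle.triangle a b c hab hac hbc, ?_⟩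
  ext e
  induction e using Sym2.ind with
  | _ p q =>
  simp only [SimpleGraph.mem_edgeSet, SimpleGraph.fromEdgeSet_adj, Set.mem_insert_iff,
    Set.mem_singleton_iff, Sym2.eq_iff] at *
  grind

/-- Gluing a polygon onto a boundary edge of a mop gives a mop. -/
lemma RPoly.glue {x y E V P} (h : RPoly x y E V P) : ∀ {E' V' C'}, MopE E' V' C' →
    s(x, y) ∈ C' → (∀ t, t ∈ V → t ∈ V' → t = x ∨ t = y) →
    MopE (E ∪ E') (V ∪ V') (C'.erase s(x, y) ∪ P) := by
  induction h with
  | leaf x y hxy =>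
    intro E' V' C' hM hC hV
    have hi := hM.inv
    have key := hi.2 _ _ (hi.1 _ hC)
    have e1 : ({s(x, y)} : Set (Sym2 ℕ)) ∪ E' = E' := by
      simpa using hi.1 _ hC
    have e2 : ({x, y} : Finset ℕ) ∪ V' = V' := by
      ext t; simp only [Finset.mem_union, Finset.mem_insert, Finset.mem_singleton]; grind
    have e3 : C'.erase s(x, y) ∪ {s(x, y)} = C' := by
      ext t; simp only [Finset.mem_union, Finset.mem_erase, Finset.mem_singleton]; grind
    rw [e1, e2, e3]; exact hM
  | node x y z E₁ E₂ V₁ V₂ P₁ P₂ h₁ h₂ hx hy hV ih₁ ih₂ =>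
    intro E' V' C' hM hC hVV
    have hi := hM.inv
    have key := hi.2 _ _ (hi.1 _ hC)
    have b₁ := h₁.base_mem
    have b₂ := h₂.base_mem
    have hz : z ∉ V' := by
      intro hz
      have := hVV z (by simp [b₂.1]) hz
      grind
    have g0 := hM.grow hC hz
    have g1 := ih₁ g0 (by simp) (by
      intro t ht ht'
      have := hVV t (by simp [ht])
      grind)
    have g2 := ih₂ g1 (by
      simp only [Finset.mem_union, Finset.mem_erase, Finset.mem_insert, Sym2.eq_iff, ne_eq]
      grind) (by
      intro t ht ht'
      have := hVV t (by simp [ht])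
      have := hV t
      grind)
    have hzx : s(x, z) ∉ C' := fun hh => hz (hi.2 _ _ (hi.1 _ hh)).2.1
    have hzy : s(z, y) ∉ C' := fun hh => hz (hi.2 _ _ (hi.1 _ hh)).1
    have hzP : s(z, y) ∉ P₁ := fun hh => hy (h₁.edge_mem _ _ (h₁.path_sub _ hh)).2.1
    have hyz : s(y, z) = s(z, y) := Sym2.eq_swap
    have hne : s(z, y) ≠ s(x, z) := by
      simp only [ne_eq, Sym2.eq_iff]; grind
    rw [hyz] at g2
    have hCE := hi.1 _ hC
    have bb1 := b₁.2.2.2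
    have bb2 := b₂.2.2.2
    convert g2 using 1
    · ext e
      simp only [Set.mem_union, Set.mem_insert_iff]
      grind
    · ext t
      simp only [Finset.mem_union, Finset.mem_insert]
      grind
    · ext e
      simp only [Finset.mem_union, Finset.mem_erase, Finset.mem_insert]
      grind

/-- A nondegenerate polygon is a mop. -/
lemma RPoly.mop {x y E V P} (h : RPoly x y E V P) (hP : 2 ≤ P.card) :
    s(x, y) ∉ P ∧ MopE E V (insert s(x, y) P) := by
  cases h with
  | leaf x y hxy => simp at hP
  | node x y z E₁ E₂ V₁ V₂ P₁ P₂ h₁ h₂ hx hy hV =>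
    refine ⟨RPoly.node_not_mem h₁ h₂ hx hy, ?_⟩
    have b₁ := h₁.base_mem
    have b₂ := h₂.base_mem
    have hxy : x ≠ y := fun hh => hx (hh ▸ b₂.2.1)
    have t0 := MopE.triangle (a := x) (b := z) (c := y) b₁.2.2.1 hxy b₂.2.2.1
    have g1 := h₁.glue t0 (by simp) (by
      intro t ht ht'
      simp only [Finset.mem_insert, Finset.mem_singleton] at ht'
      grind)
    have hne : s(z, y) ≠ s(x, z) := by
      simp only [ne_eq, Sym2.eq_iff]; grind
    have hne2 : s(x, y) ≠ s(x, z) := by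
      simp only [ne_eq, Sym2.eq_iff]; grind
    have hne3 : s(x, y) ≠ s(z, y) := by
      simp only [ne_eq, Sym2.eq_iff]; grind
    have g2 := h₂.glue g1 (by simp [hne]) (by
      intro t ht ht'
      have := hV t
      simp only [Finset.mem_insert, Finset.mem_singleton, Finset.mem_union] at ht'
      grind)
    have hzP : s(z, y) ∉ P₁ := fun hh => hy (h₁.edge_mem _ _ (h₁.path_sub _ hh)).2.1
    have bb1 := b₁.2.2.2
    have bb2 := b₂.2.2.2
    convert g2 using 1
    · ext e
      simp only [Set.mem_union, Set.mem_insert_iff, Set.mem_singleton_iff]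
      grind
    · ext t
      simp only [Finset.mem_union, Finset.mem_insert, Finset.mem_singleton]
      grind
    · ext e
      simp only [Finset.mem_union, Finset.mem_erase, Finset.mem_insert, Finset.mem_singleton]
      grind

/-- Growing a polygon at a path edge. -/
lemma RPoly.growPath {x y E V P} (h : RPoly x y E V P) : ∀ {u v w : ℕ}, s(u, v) ∈ P → w ∉ V →
    RPoly x y (insert s(u, w) (insert s(v, w) E)) (insert w V)
      (insert s(u, w) (insert s(v, w) (P.erase s(u, v)))) := by
  induction h with
  | leaf x y hxy =>
    intro u v w huv hw
    simp only [Finset.mem_insert, Finset.mem_singleton, not_or] at hw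
    have n := RPoly.node x y w _ _ _ _ _ _ (RPoly.leaf x w (Ne.symm hw.1)) (RPoly.leaf w y hw.2)
      (by simp [hxy, Ne.symm hw.1]) (by simp [hxy.symm, Ne.symm hw.2])
      (by intro t; simp only [Finset.mem_insert, Finset.mem_singleton]; grind)
    have hs : s(w, y) = s(y, w) := Sym2.eq_swap
    rw [hs] at n
    simp only [Finset.mem_singleton] at huv
    have huv' := huv
    rw [Sym2.eq_iff] at huv'
    convert n using 1
    · ext e
      simp only [Set.mem_union, Set.mem_insert_iff, Set.mem_singleton_iff]
      grind
    · ext t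
      simp only [Finset.mem_union, Finset.mem_insert, Finset.mem_singleton]
      grind
    · ext e
      simp only [Finset.mem_union, Finset.mem_erase, Finset.mem_insert, Finset.mem_singleton]
      grind
  | node x y z E₁ E₂ V₁ V₂ P₁ P₂ h₁ h₂ hx hy hV ih₁ ih₂ =>
    intro u v w huv hw
    have b₁ := h₁.base_mem
    have b₂ := h₂.base_mem
    have hd : s(u, v) ∈ P₁ → s(u, v) ∉ P₂ := fun hh => Finset.disjoint_left.1 (RPoly.disj h₁ h₂ hV) hh
    simp only [Finset.mem_union, not_or] at hw
    rcases Finset.mem_union.1 huv with huv | huv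
    · have n := RPoly.node x y z _ _ _ _ _ _ (ih₁ huv hw.1) h₂ hx
        (by simp only [Finset.mem_insert]; grind)
        (by intro t; simp only [Finset.mem_insert]; grind)
      have hd := hd huv
      convert n using 1
      · ext e
        simp only [Set.mem_union, Set.mem_insert_iff]
        grind
      · ext t
        simp only [Finset.mem_union, Finset.mem_insert]
        grind
      · ext e
        simp only [Finset.mem_union, Finset.mem_erase, Finset.mem_insert]
        grind
    · have n := RPoly.node x y z _ _ _ _ _ _ h₁ (ih₂ huv hw.2)
        (by simp only [Finset.mem_insert]; grind) hy
        (by intro t; simp only [Finset.mem_insert]; grind)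
      have hd : s(u, v) ∉ P₁ := fun hh => hd hh huv
      convert n using 1
      · ext e
        simp only [Set.mem_union, Set.mem_insert_iff]
        grind
      · ext t
        simp only [Finset.mem_union, Finset.mem_insert]
        grind
      · ext e
        simp only [Finset.mem_union, Finset.mem_erase, Finset.mem_insert]
        grind

/-- Every mop is a rooted polygon. -/
lemma exists_poly {G V C} (h : IsMopCycle G V C) :
    ∃ x y P, RPoly x y G.edgeSet V P ∧ s(x, y) ∉ P ∧ C = insert s(x, y) P := by
  induction h with
  | triangle a b c hab hac hbc =>
    have n := RPoly.node a c b _ _ _ _ _ _ (RPoly.leaf a b hab) (RPoly.leaf b c hbc)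
      (by simp [hab, hac]) (by simp [hac.symm, hbc.symm])
      (by intro t; simp only [Finset.mem_insert, Finset.mem_singleton]; grind)
    refine ⟨a, c, _, ?_, RPoly.node_not_mem (RPoly.leaf a b hab) (RPoly.leaf b c hbc)
      (by simp [hab, hac]) (by simp [hac.symm, hbc.symm]), ?_⟩
    · convert n using 1
      · ext e
        induction e using Sym2.ind with
        | _ p q =>
        simp only [SimpleGraph.mem_edgeSet, SimpleGraph.fromEdgeSet_adj, Set.mem_insert_iff,
          Set.mem_singleton_iff, Set.mem_union, Sym2.eq_iff]
        grind
      · ext t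
        simp only [Finset.mem_union, Finset.mem_insert, Finset.mem_singleton]
        grind
    · ext e
      simp only [Finset.mem_union, Finset.mem_insert, Finset.mem_singleton]
      grind
  | grow G V C u v w hG huv hw ih =>
    obtain ⟨x, y, P, hp, hxy, rfl⟩ := ih
    have b := hp.base_mem
    have hM : MopE G.edgeSet V (insert s(x, y) P) := ⟨G, hG, rfl⟩
    have key := hM.inv.2 _ _ (hM.inv.1 _ huv)
    have hE : (SimpleGraph.fromEdgeSet
        (insert s(u, w) (insert s(v, w) G.edgeSet))).edgeSet =
        insert s(u, w) (insert s(v, w) G.edgeSet) := by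
      ext e
      induction e using Sym2.ind with
      | _ p q =>
      have h2 := hM.inv.2 p q
      simp only [SimpleGraph.mem_edgeSet, SimpleGraph.fromEdgeSet_adj, Set.mem_insert_iff,
        Sym2.eq_iff] at *
      grind
    rw [hE]
    by_cases hc : s(u, v) = s(x, y)
    · have hyw : y ≠ w := fun hh => hw (hh ▸ b.2.1)
      have hxw : x ≠ w := fun hh => hw (hh ▸ b.1)
      have n := RPoly.node x w y _ _ _ _ _ _ hp (RPoly.leaf y w hyw)
        (by simp [b.2.2.1, hxw]) hw
        (by intro t; simp only [Finset.mem_insert, Finset.mem_singleton]; grind)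
      refine ⟨x, w, _, ?_, RPoly.node_not_mem hp (RPoly.leaf y w hyw)
        (by simp [b.2.2.1, hxw]) hw, ?_⟩
      · have hc' := hc
        rw [Sym2.eq_iff] at hc'
        convert n using 1
        · ext e
          simp only [Set.mem_insert_iff, Set.mem_singleton_iff, Set.mem_union]
          grind
        · ext t
          simp only [Finset.mem_union, Finset.mem_insert, Finset.mem_singleton]
          grind
      · have hc' := hc
        rw [Sym2.eq_iff] at hc'
        ext e
        simp only [Finset.mem_union, Finset.mem_erase, Finset.mem_insert, Finset.mem_singleton]
        grind
    · have huP : s(u, v) ∈ P := by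
        simpa [hc] using huv
      refine ⟨x, y, _, hp.growPath huP hw, ?_, ?_⟩
      · simp only [Finset.mem_insert, Finset.mem_erase, Sym2.eq_iff]
        grind
      · ext e
        simp only [Finset.mem_erase, Finset.mem_insert]
        grind

/-- Descent: inside a polygon glued to a mop, find the diagonal. -/
lemma RPoly.descend {x y E V P} (h : RPoly x y E V P) : ∀ {E' V' C'}, MopE E' V' C' →
    s(x, y) ∈ C' → (∀ t, t ∈ V → t ∈ V' → t = x ∨ t = y) → 5 ≤ P.card →
    ∃ a b E₁ E₂ V₁ V₂ C₁ C₂ P₁, MopE E₁ V₁ C₁ ∧ MopE E₂ V₂ C₂ ∧ E ∪ E' = E₁ ∪ E₂ ∧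
      V ∪ V' = V₁ ∪ V₂ ∧ s(a, b) ∈ E₁ ∧ s(a, b) ∈ C₂ ∧ s(a, b) ∉ P₁ ∧ (∀ e ∈ P₁, e ∈ E₁) ∧
      (∀ t, t ∈ V₁ → t ∈ V₂ → t = a ∨ t = b) ∧
      C'.erase s(x, y) ∪ P = C₂.erase s(a, b) ∪ P₁ ∧ 5 ≤ P₁.card ∧ P₁.card ≤ 8 := by
  induction h with
  | leaf x y hxy =>
    intro E' V' C' hM hC hV hP
    simp at hP
  | node x y z E₁ E₂ V₁ V₂ P₁ P₂ h₁ h₂ hx hy hV ih₁ ih₂ =>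
    intro E' V' C' hM hC hVV hP
    by_cases h8 : (P₁ ∪ P₂).card ≤ 8
    · have hp := RPoly.node x y z _ _ _ _ _ _ h₁ h₂ hx hy hV
      obtain ⟨m1, m2⟩ := hp.mop (by omega)
      exact ⟨x, y, _, _, _, _, _, _, _, m2, hM, rfl, rfl, by simp, hC, m1, hp.path_sub, hVV, rfl,
        hP, h8⟩
    · rw [Finset.card_union_of_disjoint (RPoly.disj h₁ h₂ hV)] at h8
      have hi := hM.inv
      have key := hi.2 _ _ (hi.1 _ hC)
      have b₁ := h₁.base_mem
      have b₂ := h₂.base_mem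
      have hz : z ∉ V' := by
        intro hz
        have := hVV z (by simp [b₂.1]) hz
        grind
      have g0 := hM.grow hC hz
      have hzx : s(x, z) ∉ C' := fun hh => hz (hi.2 _ _ (hi.1 _ hh)).2.1
      have hzy : s(z, y) ∉ C' := fun hh => hz (hi.2 _ _ (hi.1 _ hh)).1
      have hzP : s(z, y) ∉ P₁ := fun hh => hy (h₁.edge_mem _ _ (h₁.path_sub _ hh)).2.1
      have hzP2 : s(x, z) ∉ P₂ := fun hh => hx (h₂.edge_mem _ _ (h₂.path_sub _ hh)).1
      have hyz : s(y, z) = s(z, y) := Sym2.eq_swap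
      have hne : s(z, y) ≠ s(x, z) := by
        simp only [ne_eq, Sym2.eq_iff]; grind
      have hCE := hi.1 _ hC
      have bb1 := b₁.2.2.2
      have bb2 := b₂.2.2.2
      rw [hyz] at g0
      rcases (by omega : 5 ≤ P₁.card ∨ 5 ≤ P₂.card) with h5 | h5
      · have g1 := h₂.glue g0 (by simp) (by
          intro t ht ht'
          have := hVV t (by simp [ht])
          grind)
        obtain ⟨a, b, F₁, F₂, W₁, W₂, D₁, D₂, Q, r1, r2, r3, r4, r5, r6, r7, r8, r9, r10, r11⟩ :=
          ih₁ g1 (by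
            simp only [Finset.mem_union, Finset.mem_erase, Finset.mem_insert]
            grind) (by
            intro t ht ht'
            have := hVV t (by simp [ht])
            have := hV t
            grind) h5
        refine ⟨a, b, F₁, F₂, W₁, W₂, D₁, D₂, Q, r1, r2, ?_, ?_, r5, r6, r7, r8, r9, ?_, r11⟩
        · rw [← r3]
          ext e
          simp only [Set.mem_union, Set.mem_insert_iff]
          grind
        · rw [← r4]
          ext t
          simp only [Finset.mem_union, Finset.mem_insert]
          grind
        · rw [← r10]
          ext e
          simp only [Finset.mem_union, Finset.mem_erase, Finset.mem_insert]
          grind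
      · have g1 := h₁.glue g0 (by simp) (by
          intro t ht ht'
          have := hVV t (by simp [ht])
          grind)
        obtain ⟨a, b, F₁, F₂, W₁, W₂, D₁, D₂, Q, r1, r2, r3, r4, r5, r6, r7, r8, r9, r10, r11⟩ :=
          ih₂ g1 (by
            simp only [Finset.mem_union, Finset.mem_erase, Finset.mem_insert]
            grind) (by
            intro t ht ht'
            have := hVV t (by simp [ht])
            have := hV t
            grind) h5
        refine ⟨a, b, F₁, F₂, W₁, W₂, D₁, D₂, Q, r1, r2, ?_, ?_, r5, r6, r7, r8, r9, ?_, r11⟩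
        · rw [← r3]
          ext e
          simp only [Set.mem_union, Set.mem_insert_iff]
          grind
        · rw [← r4]
          ext t
          simp only [Finset.mem_union, Finset.mem_insert]
          grind
        · rw [← r10]
          ext e
          simp only [Finset.mem_union, Finset.mem_erase, Finset.mem_insert]
          grind

/-- The descent started at the root. -/
lemma RPoly.root {x y E V P} (h : RPoly x y E V P) (hP : 9 ≤ P.card) :
    ∃ a b E₁ E₂ V₁ V₂ C₁ C₂ P₁, MopE E₁ V₁ C₁ ∧ MopE E₂ V₂ C₂ ∧ E = E₁ ∪ E₂ ∧
      V = V₁ ∪ V₂ ∧ s(a, b) ∈ E₁ ∧ s(a, b) ∈ C₂ ∧ s(a, b) ∉ P₁ ∧ (∀ e ∈ P₁, e ∈ E₁) ∧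
      (∀ t, t ∈ V₁ → t ∈ V₂ → t = a ∨ t = b) ∧
      insert s(x, y) P = C₂.erase s(a, b) ∪ P₁ ∧ 5 ≤ P₁.card ∧ P₁.card ≤ 8 := by
  cases h with
  | leaf x y hxy => simp at hP
  | node x y z E₁ E₂ V₁ V₂ P₁ P₂ h₁ h₂ hx hy hV =>
    rw [Finset.card_union_of_disjoint (RPoly.disj h₁ h₂ hV)] at hP
    have b₁ := h₁.base_mem
    have b₂ := h₂.base_mem
    have hxy : x ≠ y := fun hh => hx (hh ▸ b₂.2.1)
    have t0 := MopE.triangle (a := x) (b := z) (c := y) b₁.2.2.1 hxy b₂.2.2.1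
    have hzP : s(z, y) ∉ P₁ := fun hh => hy (h₁.edge_mem _ _ (h₁.path_sub _ hh)).2.1
    have hzP2 : s(x, z) ∉ P₂ := fun hh => hx (h₂.edge_mem _ _ (h₂.path_sub _ hh)).1
    have hne : s(z, y) ≠ s(x, z) := by
      simp only [ne_eq, Sym2.eq_iff]; grind
    have hne2 : s(x, y) ≠ s(x, z) := by
      simp only [ne_eq, Sym2.eq_iff]; grind
    have hne3 : s(x, y) ≠ s(z, y) := by
      simp only [ne_eq, Sym2.eq_iff]; grind
    have bb1 := b₁.2.2.2
    have bb2 := b₂.2.2.2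
    rcases (by omega : 5 ≤ P₁.card ∨ 5 ≤ P₂.card) with h5 | h5
    · have g1 := h₂.glue t0 (by simp) (by
        intro t ht ht'
        simp only [Finset.mem_insert, Finset.mem_singleton] at ht'
        grind)
      obtain ⟨a, b, F₁, F₂, W₁, W₂, D₁, D₂, Q, r1, r2, r3, r4, r5, r6, r7, r8, r9, r10, r11⟩ :=
        h₁.descend g1 (by simp [hne.symm]) (by
          intro t ht ht'
          have := hV t
          simp only [Finset.mem_insert, Finset.mem_singleton, Finset.mem_union] at ht'
          grind) h5
      refine ⟨a, b, F₁, F₂, W₁, W₂, D₁, D₂, Q, r1, r2, ?_, ?_, r5, r6, r7, r8, r9, ?_, r11⟩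
      · rw [← r3]
        ext e
        simp only [Set.mem_union, Set.mem_insert_iff, Set.mem_singleton_iff]
        grind
      · rw [← r4]
        ext t
        simp only [Finset.mem_union, Finset.mem_insert, Finset.mem_singleton]
        grind
      · rw [← r10]
        ext e
        simp only [Finset.mem_union, Finset.mem_erase, Finset.mem_insert, Finset.mem_singleton]
        grind
    · have g1 := h₁.glue t0 (by simp) (by
        intro t ht ht'
        simp only [Finset.mem_insert, Finset.mem_singleton] at ht'
        grind)
      obtain ⟨a, b, F₁, F₂, W₁, W₂, D₁, D₂, Q, r1, r2, r3, r4, r5, r6, r7, r8, r9, r10, r11⟩ :=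
        h₂.descend g1 (by simp [hne]) (by
          intro t ht ht'
          have := hV t
          simp only [Finset.mem_insert, Finset.mem_singleton, Finset.mem_union] at ht'
          grind) h5
      refine ⟨a, b, F₁, F₂, W₁, W₂, D₁, D₂, Q, r1, r2, ?_, ?_, r5, r6, r7, r8, r9, ?_, r11⟩
      · rw [← r3]
        ext e
        simp only [Set.mem_union, Set.mem_insert_iff, Set.mem_singleton_iff]
        grind
      · rw [← r4]
        ext t
        simp only [Finset.mem_union, Finset.mem_insert, Finset.mem_singleton]
        grind
      · rw [← r10]
        ext e
        simp only [Finset.mem_union, Finset.mem_erase, Finset.mem_insert, Finset.mem_singleton]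
        grind

/-- **Lemma 6 (O'Rourke).** A mop of order `n ≥ 10` has a diagonal `d = xy` which
partitions it into two mops `G₁` and `G₂` such that `G₁` contains exactly `5`, `6`,
`7` or `8` Hamiltonian edges of `G`. -/
theorem mop_exists_diagonal_partition_five_to_eight (G : SimpleGraph ℕ) (V : Finset ℕ)
    (C : Finset (Sym2 ℕ)) (h : IsMopCycle G V C) (hn : 10 ≤ V.card) :
    ∃ (x y : ℕ) (G₁ G₂ : SimpleGraph ℕ) (V₁ V₂ : Finset ℕ),
      G.Adj x y ∧ s(x, y) ∉ C ∧
      IsMop G₁ V₁ ∧ IsMop G₂ V₂ ∧ G = G₁ ⊔ G₂ ∧ V = V₁ ∪ V₂ ∧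
      V₁ ∩ V₂ = ({x, y} : Finset ℕ) ∧
      G₁.edgeSet ∩ G₂.edgeSet = {s(x, y)} ∧
      ((C : Set (Sym2 ℕ)) ∩ G₁.edgeSet).ncard ∈ ({5, 6, 7, 8} : Set ℕ) := by
  obtain ⟨x, y, P, hp, hxy, rfl⟩ := exists_poly h
  have hc := hp.card
  obtain ⟨a, b, E₁, E₂, V₁, V₂, C₁, C₂, Q, m1, m2, hE, hV, hab, habC, habQ, hQ, hVV, hC, h5, h8⟩ :=
    hp.root (by omega)
  have i1 := m1.inv
  have i2 := m2.inv
  have k1 := i1.2 _ _ hab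
  have k2 := i2.2 _ _ (i2.1 _ habC)
  have hint : ∀ e, e ∈ E₁ → e ∈ E₂ → e = s(a, b) := by
    intro e he he'
    induction e using Sym2.ind with
    | _ p q =>
    have p1 := i1.2 _ _ he
    have p2 := i2.2 _ _ he'
    have := hVV p p1.1 p2.1
    have := hVV q p1.2.1 p2.2.1
    rw [Sym2.eq_iff]
    grind
  have habE₂ := i2.1 _ habC
  obtain ⟨G₁, c1, rfl⟩ := m1
  obtain ⟨G₂, c2, rfl⟩ := m2
  refine ⟨a, b, G₁, G₂, V₁, V₂, ?_, ?_, ⟨_, c1⟩, ⟨_, c2⟩, ?_, hV, ?_, ?_, ?_⟩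
  · rw [← SimpleGraph.mem_edgeSet, hE]
    exact Or.inl hab
  · rw [hC]
    simp [habQ]
  · rw [← SimpleGraph.edgeSet_inj, SimpleGraph.edgeSet_sup, hE]
  · ext t
    have := hVV t
    simp only [Finset.mem_inter, Finset.mem_insert, Finset.mem_singleton]
    grind
  · ext e
    have := hint e
    simp only [Set.mem_inter_iff, Set.mem_singleton_iff]
    grind
  · have hfin : ((insert s(x, y) P : Finset (Sym2 ℕ)) : Set (Sym2 ℕ)) ∩ G₁.edgeSet
        = (Q : Set (Sym2 ℕ)) := by
      rw [hC]
      ext e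
      have := hint e
      have := i2.1 e
      have := hQ e
      simp only [Set.mem_inter_iff, Finset.mem_coe, Finset.mem_union, Finset.mem_erase]
      grind
    rw [hfin, Set.ncard_coe_finset]
    simp only [Set.mem_insert_iff, Set.mem_singleton_iff]
    omega
end

section
/- (O'Rourke) If G is a maximal outerplanar graph of order n ≥ 4, e is a Hamiltonian edge of G, and G' is the graph obtained from G by contracting the edge e (deleting the two endpoints u, v of e, adding a new vertex x, and making x adjacent exactly to the vertices in N(u) ∪ N(v) other than u and v), then G' is a maximal outerplanar graph. -/
open SimpleGraph

/-- The edge contraction of `G` along the edge `uv`: delete `u` and `v`, add a new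
vertex `x`, and make `x` adjacent exactly to the vertices of `N(u) ∪ N(v)` other
than `u` and `v`. -/
def contractEdge (G : SimpleGraph ℕ) (u v x : ℕ) : SimpleGraph ℕ :=
  SimpleGraph.fromRel (fun a b =>
    (G.Adj a b ∧ a ≠ u ∧ a ≠ v ∧ b ≠ u ∧ b ≠ v) ∨
    (a = x ∧ b ≠ u ∧ b ≠ v ∧ (G.Adj u b ∨ G.Adj v b)))


theorem mop_grow_ext {G : SimpleGraph ℕ} {V : Finset ℕ} {C : Finset (Sym2 ℕ)} (u v w : ℕ)
    (hG : IsMopCycle G V C) (huv : s(u, v) ∈ C) (hw : w ∉ V)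
    (G' : SimpleGraph ℕ) (V' : Finset ℕ)
    (hG' : ∀ a b, G'.Adj a b ↔ (a ≠ b ∧ (G.Adj a b ∨ s(a, b) = s(u, w) ∨ s(a, b) = s(v, w))))
    (hV' : ∀ a, a ∈ V' ↔ a = w ∨ a ∈ V) :
    IsMopCycle G' V' (insert s(u, w) (insert s(v, w) (C.erase s(u, v)))) := by
  have h := IsMopCycle.grow G V C u v w hG huv hw
  have e1 : G' = SimpleGraph.fromEdgeSet (insert s(u, w) (insert s(v, w) G.edgeSet)) := by
    ext a b
    rw [hG' a b]
    simp only [fromEdgeSet_adj, Set.mem_insert_iff, mem_edgeSet]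
    tauto
  have e2 : V' = insert w V := by
    ext a; rw [hV' a]; simp
  rw [e1, e2]; exact h

theorem mop_triangle_ext (a b c : ℕ) (hab : a ≠ b) (hac : a ≠ c) (hbc : b ≠ c)
    (G' : SimpleGraph ℕ) (V' : Finset ℕ)
    (hG' : ∀ i j, G'.Adj i j ↔ (i ≠ j ∧ (s(i, j) = s(a, b) ∨ s(i, j) = s(b, c) ∨ s(i, j) = s(a, c))))
    (hV' : ∀ i, i ∈ V' ↔ i = a ∨ i = b ∨ i = c) :
    IsMopCycle G' V' {s(a, b), s(b, c), s(a, c)} := by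
  have h := IsMopCycle.triangle a b c hab hac hbc
  have e1 : G' = SimpleGraph.fromEdgeSet {s(a, b), s(b, c), s(a, c)} := by
    ext i j
    rw [hG' i j]
    simp only [fromEdgeSet_adj, Set.mem_insert_iff, Set.mem_singleton_iff]
    tauto
  have e2 : V' = {a, b, c} := by
    ext i; rw [hV' i]; simp
  rw [e1, e2]; exact h

theorem mop_basic {G : SimpleGraph ℕ} {V : Finset ℕ} {C : Finset (Sym2 ℕ)}
    (h : IsMopCycle G V C) :
    (∀ a b, s(a, b) ∈ C → G.Adj a b) ∧ (∀ a b, G.Adj a b → a ∈ V ∧ b ∈ V) := by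
  induction h with
  | triangle a b c hab hac hbc =>
    constructor
    · intro i j hij
      simp only [Finset.mem_insert, Finset.mem_singleton, Sym2.eq_iff] at hij
      simp only [fromEdgeSet_adj, Set.mem_insert_iff, Set.mem_singleton_iff, Sym2.eq_iff]
      grind
    · intro i j hij
      simp only [fromEdgeSet_adj, Set.mem_insert_iff, Set.mem_singleton_iff, Sym2.eq_iff] at hij
      simp only [Finset.mem_insert, Finset.mem_singleton]
      grind
  | grow G V C u v w hG huv hw ih =>
    obtain ⟨h1, h2⟩ := ih
    have h3 := h2 u v (h1 u v huv)
    constructor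
    · intro i j hij
      simp only [Finset.mem_insert, Finset.mem_erase, Sym2.eq_iff] at hij
      simp only [fromEdgeSet_adj, Set.mem_insert_iff, mem_edgeSet, Sym2.eq_iff]
      have := h1 i j
      have h4 : G.Adj i j → i ≠ j := fun h => h.ne
      grind
    · intro i j hij
      simp only [fromEdgeSet_adj, Set.mem_insert_iff, mem_edgeSet, Sym2.eq_iff] at hij
      simp only [Finset.mem_insert]
      have := h2 i j
      grind

theorem mop_no_triangle {G : SimpleGraph ℕ} {V : Finset ℕ} {C : Finset (Sym2 ℕ)}
    (h : IsMopCycle G V C) : ∀ a b c, s(a, b) ∈ C → s(b, c) ∈ C → s(a, c) ∈ C →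
      V = {a, b, c} ∧ ∀ p q, s(p, q) ∈ C → s(p, q) = s(a, b) ∨ s(p, q) = s(b, c) ∨
        s(p, q) = s(a, c) := by
  induction h with
  | triangle a b c hab hac hbc =>
    intro i j k h1 h2 h3
    simp only [Finset.mem_insert, Finset.mem_singleton, Sym2.eq_iff] at h1 h2 h3 ⊢
    constructor
    · ext t
      simp only [Finset.mem_insert, Finset.mem_singleton]
      grind
    · grind
  | grow G V C u v w hG huv hw ih =>
    intro i j k h1 h2 h3
    exfalso
    obtain ⟨b1, b2⟩ := mop_basic hG
    have b3 : ∀ a b, s(a, b) ∈ C → a ∈ V ∧ b ∈ V := fun a b hab => b2 a b (b1 a b hab)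
    have b4 : ∀ a b, s(a, b) ∈ C → a ≠ b := fun a b hab => (b1 a b hab).ne
    have b5 := ih i j k
    have i1 := b3 i j
    have i2 := b3 j k
    have i3 := b3 i k
    have i4 := b3 u v huv
    have j1 := b4 i j
    have j2 := b4 j k
    have j3 := b4 i k
    have j4 := b4 u v huv
    simp only [Finset.mem_insert, Finset.mem_erase, ne_eq] at h1 h2 h3
    by_cases hc : s(i, j) ∈ C ∧ s(j, k) ∈ C ∧ s(i, k) ∈ C
    · obtain ⟨c1, c2, c3⟩ := hc
      obtain ⟨-, b6⟩ := b5 c1 c2 c3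
      have b7 := b6 u v huv
      simp only [Sym2.eq_iff] at *
      grind
    · clear b5 ih b1 b2 b3 b4 huv hG
      simp only [Sym2.eq_iff] at *
      generalize (s(i, j) ∈ C) = P1 at *
      generalize (s(j, k) ∈ C) = P2 at *
      generalize (s(i, k) ∈ C) = P3 at *
      rcases h1 with (h1 | h1) | (h1 | h1) | h1 <;> rcases h2 with (h2 | h2) | (h2 | h2) | h2 <;>
        rcases h3 with (h3 | h3) | (h3 | h3) | h3 <;> grind

theorem mop_rename {G : SimpleGraph ℕ} {V : Finset ℕ} {C : Finset (Sym2 ℕ)}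
    (h : IsMopCycle G V C) (f : ℕ → ℕ) (hf : Function.Involutive f) :
    IsMopCycle (G.comap f) (V.image f) (C.image (Sym2.map f)) := by
  have hi := hf.injective
  have key : ∀ i j, f i = j ↔ i = f j := fun i j => ⟨fun h => by rw [← h, hf], fun h => by rw [h, hf]⟩
  induction h with
  | triangle a b c hab hac hbc =>
    simp only [Finset.image_insert, Finset.image_singleton, Sym2.map_mk]
    apply mop_triangle_ext _ _ _ (hi.ne hab) (hi.ne hac) (hi.ne hbc)
    · intro i j
      simp only [comap_adj, fromEdgeSet_adj, Set.mem_insert_iff, Set.mem_singleton_iff, Sym2.eq_iff,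
        key, hi.ne_iff]
      tauto
    · intro i; simp
  | grow G V C u v w hG huv hw ih =>
    have hS : Function.Injective (Sym2.map f) := Sym2.map.injective hi
    have e : (insert s(u, w) (insert s(v, w) (C.erase s(u, v)))).image (Sym2.map f) =
      insert s(f u, f w) (insert s(f v, f w) ((C.image (Sym2.map f)).erase s(f u, f v))) := by
      simp only [Finset.image_insert, Sym2.map_mk, Finset.image_erase hS]
    rw [e]
    apply mop_grow_ext _ _ _ ih
    · exact Finset.mem_image.2 ⟨_, huv, rfl⟩
    · rw [hi.mem_finset_image]; exact hw
    · intro i j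
      simp only [comap_adj, fromEdgeSet_adj, Set.mem_insert_iff, mem_edgeSet, Sym2.eq_iff,
        key, hi.ne_iff]
      tauto
    · intro i; simp

/-- The vertex map of the contraction. -/
def cmap (u v x a : ℕ) : ℕ := if a = u ∨ a = v then x else a

def ContrGood (G : SimpleGraph ℕ) (V : Finset ℕ) (C : Finset (Sym2 ℕ)) (u v x : ℕ) : Prop :=
  ∃ C', IsMopCycle (contractEdge G u v x) (insert x (V \ {u, v})) C' ∧
    ∀ a b, s(a, b) ∈ C → cmap u v x a ≠ cmap u v x b → s(cmap u v x a, cmap u v x b) ∈ C'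

theorem ContrGood.symm {G : SimpleGraph ℕ} {V : Finset ℕ} {C : Finset (Sym2 ℕ)} {u v x : ℕ}
    (h : ContrGood G V C u v x) : ContrGood G V C v u x := by
  have e1 : contractEdge G v u x = contractEdge G u v x := by
    unfold contractEdge
    congr 1
    ext a b
    constructor
    · rintro (⟨h1, h2, h3, h4, h5⟩ | ⟨h1, h2, h3, h4⟩)
      · exact Or.inl ⟨h1, h3, h2, h5, h4⟩
      · exact Or.inr ⟨h1, h3, h2, h4.symm⟩
    · rintro (⟨h1, h2, h3, h4, h5⟩ | ⟨h1, h2, h3, h4⟩)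
      · exact Or.inl ⟨h1, h3, h2, h5, h4⟩
      · exact Or.inr ⟨h1, h3, h2, h4.symm⟩
  have e2 : cmap v u x = cmap u v x := by
    ext a; simp only [cmap, or_comm]
  unfold ContrGood at *
  rw [e1, e2, Finset.pair_comm]; exact h

theorem contr_ear {G : SimpleGraph ℕ} {V : Finset ℕ} {C : Finset (Sym2 ℕ)} {u v w x : ℕ}
    (hG : IsMopCycle G V C) (huv : s(u, v) ∈ C) (hw : w ∉ V) (hx : x ∉ V) (hxw : x ≠ w) :
    ContrGood (SimpleGraph.fromEdgeSet (insert s(u, w) (insert s(v, w) G.edgeSet)))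
      (insert w V) (insert s(u, w) (insert s(v, w) (C.erase s(u, v)))) u w x := by
  obtain ⟨b1, b2⟩ := mop_basic hG
  have buv := b2 u v (b1 u v huv)
  have hadj := b1 u v huv
  have hne := hadj.ne
  have hr := mop_rename hG (Equiv.swap u x) (fun a => Equiv.swap_apply_self u x a)
  have hfx : Equiv.swap u x x = u := Equiv.swap_apply_right u x
  have hfu : Equiv.swap u x u = x := Equiv.swap_apply_left u x
  have hfo : ∀ a, a ≠ u → a ≠ x → Equiv.swap u x a = a :=
    fun a => Equiv.swap_apply_of_ne_of_ne
  refine ⟨C.image (Sym2.map (Equiv.swap u x)), ?_, ?_⟩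
  · convert hr using 1
    · ext a b
      simp only [contractEdge, fromRel_adj, comap_adj, fromEdgeSet_adj, Set.mem_insert_iff,
        mem_edgeSet, Sym2.eq_iff]
      have c1 := b2 a b
      have c2 := b2 u a
      have c3 := b2 u b
      have c4 := b2 w a
      have c5 := b2 w b
      have c6 := b2 x b
      have c7 := b2 a x
      have d1 : G.Adj u u → False := fun h => h.ne rfl
      have d2 : ∀ i j, G.Adj i j ↔ G.Adj j i := fun i j => G.adj_comm i j
      have d3 : G.Adj a b → a ≠ b := fun h => h.ne
      have d4 := d2 a b
      have d5 := d2 a u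
      have d6 := d2 b u
      have d7 := b2 a u
      have d8 := b2 b u
      have hxu : x ≠ u := by grind
      have hwu : w ≠ u := by grind
      have hwv : w ≠ v := by grind
      have hxv : x ≠ v := by grind
      have nw : ∀ i, ¬ G.Adj w i := fun i h => hw (b2 _ _ h).1
      have nw' : ∀ i, ¬ G.Adj i w := fun i h => hw (b2 _ _ h).2
      have nx : ∀ i, ¬ G.Adj x i := fun i h => hx (b2 _ _ h).1
      have nx' : ∀ i, ¬ G.Adj i x := fun i h => hx (b2 _ _ h).2
      clear b1 b2 d2 hr hG huv
      by_cases ha : a = x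
      · subst ha
        by_cases hb : b = a
        · subst hb; simp
        by_cases hb' : b = u
        · subst hb'; rw [hfx, hfu]; simp [nx', hxu, hb]
        · rw [hfx, hfo b hb' hb]; clear hfx hfu hfo
          by_cases hbv : b = v
          · grind
          · grind
      by_cases hb : b = x
      · subst hb
        by_cases ha' : a = u
        · subst ha'; rw [hfx, hfu]; simp [nx, nx', hxu, ha]
        · rw [hfx, hfo a ha' ha]; clear hfx hfu hfo
          by_cases hbv : a = v
          · grind
          · grind
      by_cases ha' : a = u
      · subst ha'; rw [hfu]; simp [nx, ha]
      by_cases hb' : b = u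
      · subst hb'; rw [hfu]; simp [nx', hb]
      rw [hfo a ha' ha, hfo b hb' hb]; clear hfx hfu hfo
      by_cases haw : a = w
      · grind
      · by_cases hbw : b = w
        · grind
        · grind
    · ext a
      simp only [Finset.mem_insert, Finset.mem_sdiff, Finset.mem_singleton, Finset.mem_image]
      constructor
      · rintro (h | h)
        · exact ⟨u, buv.1, by rw [h, hfu]⟩
        · exact ⟨a, by grind, hfo a (by grind) (by grind)⟩
      · rintro ⟨b, hb, rfl⟩
        by_cases hbu : b = u
        · left; rw [hbu, hfu]
        · right; rw [hfo b hbu (by grind)]; grind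
  · have hc : ∀ a, a ∈ V → cmap u w x a = Equiv.swap u x a := by
      intro a ha; unfold cmap; grind
    have hm : ∀ a b, s(a, b) ∈ C →
        s(cmap u w x a, cmap u w x b) ∈ C.image (Sym2.map (Equiv.swap u x)) := by
      intro a b hab
      have := b2 a b (b1 a b hab)
      rw [hc a this.1, hc b this.2]
      exact Finset.mem_image.2 ⟨_, hab, rfl⟩
    have hmw : cmap u w x w = cmap u w x u := by simp [cmap]
    intro a b hab hne
    simp only [Finset.mem_insert, Finset.mem_erase] at hab
    rcases hab with h | h | h
    · rw [Sym2.eq_iff] at h; grind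
    · rw [Sym2.eq_iff] at h
      rcases h with ⟨rfl, rfl⟩ | ⟨rfl, rfl⟩
      · rw [hmw, Sym2.eq_swap]; exact hm _ _ huv
      · rw [hmw]; exact hm _ _ huv
    · exact hm _ _ h.2

theorem grow_swap (G : SimpleGraph ℕ) (V : Finset ℕ) (C : Finset (Sym2 ℕ)) (u v w y z x : ℕ)
    (h : ContrGood (SimpleGraph.fromEdgeSet (insert s(u, w) (insert s(v, w) G.edgeSet)))
      (insert w V) (insert s(u, w) (insert s(v, w) (C.erase s(u, v)))) y z x) :
    ContrGood (SimpleGraph.fromEdgeSet (insert s(v, w) (insert s(u, w) G.edgeSet)))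
      (insert w V) (insert s(v, w) (insert s(u, w) (C.erase s(v, u)))) y z x := by
  rw [Set.insert_comm, Finset.insert_comm, Sym2.eq_swap (a := v) (b := u)]; exact h

theorem contr_tri {a b c p q w u v x : ℕ} (hab : a ≠ b) (hac : a ≠ c) (hbc : b ≠ c)
    (hw : w ∉ ({a, b, c} : Finset ℕ)) (hx : x ∉ ({a, b, c} : Finset ℕ)) (hxw : x ≠ w)
    (hpq : s(p, q) ∈ ({s(a, b), s(b, c), s(a, c)} : Finset (Sym2 ℕ)))
    (huv : s(u, v) ∈ ({s(a, b), s(b, c), s(a, c)} : Finset (Sym2 ℕ)))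
    (hne : s(u, v) ≠ s(p, q)) (G : SimpleGraph ℕ)
    (hG : G = SimpleGraph.fromEdgeSet {s(a, b), s(b, c), s(a, c)}) :
    ContrGood (SimpleGraph.fromEdgeSet (insert s(p, w) (insert s(q, w) G.edgeSet)))
      (insert w {a, b, c}) (insert s(p, w) (insert s(q, w)
        (({s(a, b), s(b, c), s(a, c)} : Finset (Sym2 ℕ)).erase s(p, q)))) u v x := by
  have hGa : ∀ i j, G.Adj i j ↔ (i ≠ j ∧ (i = a ∨ i = b ∨ i = c) ∧ (j = a ∨ j = b ∨ j = c)) := by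
    intro i j
    subst hG
    simp only [fromEdgeSet_adj, Set.mem_insert_iff, Set.mem_singleton_iff, Sym2.eq_iff]
    grind
  clear hG
  simp only [Finset.mem_insert, Finset.mem_singleton, not_or] at hw hx hpq huv
  obtain ⟨t, ht1, ht2, ht3, ht4⟩ : ∃ t, t ≠ u ∧ t ≠ v ∧ u ≠ v ∧
      ∀ i, (i = a ∨ i = b ∨ i = c) ↔ (i = u ∨ i = v ∨ i = t) := by
    simp only [Sym2.eq_iff] at huv
    rcases huv with h | h | h
    · exact ⟨c, by grind, by grind, by grind, by grind⟩
    · exact ⟨a, by grind, by grind, by grind, by grind⟩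
    · exact ⟨b, by grind, by grind, by grind, by grind⟩
  simp only [ht4] at hGa
  have hp : (p = t ∧ (q = u ∨ q = v)) ∨ (q = t ∧ (p = u ∨ p = v)) := by
    have := ht4 p
    have := ht4 q
    simp only [ne_eq, Sym2.eq_iff] at hpq hne
    grind
  have hxt : x ≠ u ∧ x ≠ v ∧ x ≠ t := by have := ht4 x; grind
  have hwt : w ≠ u ∧ w ≠ v ∧ w ≠ t := by have := ht4 w; grind
  refine ⟨_, mop_triangle_ext x t w hxt.2.2 hxw hwt.2.2.symm _ _ ?_ ?_, ?_⟩
  · intro i j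
    simp only [contractEdge, fromRel_adj, fromEdgeSet_adj, Set.mem_insert_iff,
        mem_edgeSet, Sym2.eq_iff, hGa]
    clear ht4 hGa hpq huv hne hab hac hbc hw hx
    grind
  · intro i
    have := ht4 i
    simp only [Finset.mem_insert, Finset.mem_sdiff, Finset.mem_singleton]
    grind
  · intro i j hij hc
    have hij' : (i = w ∨ i = u ∨ i = v ∨ i = t) ∧ (j = w ∨ j = u ∨ j = v ∨ j = t) := by
      have := ht4 i
      have := ht4 j
      simp only [Finset.mem_insert, Finset.mem_erase, Finset.mem_singleton, Sym2.eq_iff] at hij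
      grind
    simp only [Finset.mem_insert, Finset.mem_singleton, Sym2.eq_iff]
    clear ht4 hGa hij hpq huv
    unfold cmap at *
    grind

theorem mop_card {G : SimpleGraph ℕ} {V : Finset ℕ} {C : Finset (Sym2 ℕ)}
    (h : IsMopCycle G V C) : 3 ≤ V.card := by
  induction h with
  | triangle a b c hab hac hbc => rw [Finset.card_eq_three.2 ⟨a, b, c, hab, hac, hbc, rfl⟩]
  | grow G V C u v w hG huv hw ih => rw [Finset.card_insert_of_notMem hw]; omega

theorem cmap_eq {u v x a b : ℕ} (ha : a ≠ x) (hb : b ≠ x) (h : cmap u v x a = cmap u v x b) :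
    a = b ∨ ((a = u ∨ a = v) ∧ (b = u ∨ b = v)) := by
  unfold cmap at h
  split_ifs at h <;> grind

theorem cmap_inj_aux {u v x p q i j : ℕ} (R : ℕ → ℕ → Prop) (sw : ∀ a b, R a b → R b a)
    (nt : ∀ a b c, R a b → R b c → R a c → False) (huv : R u v) (hpq : R p q) (hij : R i j)
    (hp : p ≠ x) (hq : q ≠ x) (hi : i ≠ x) (hj : j ≠ x)
    (h1 : ¬ (i = p ∧ j = q)) (hc : cmap u v x i ≠ cmap u v x j)
    (g1 : cmap u v x i = cmap u v x p) (g2 : cmap u v x j = cmap u v x q) : False := by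
  have hvu := sw _ _ huv
  have key : ∀ t a b, (a = u ∨ a = v) → (b = u ∨ b = v) → a ≠ b → R t a → R t b → False := by
    intro t a b ha hb hab h2 h3
    have hR : R a b := by grind
    exact nt t a b h2 hR h3
  rcases cmap_eq hi hp g1 with e1 | ⟨e1, e2⟩
  · subst e1
    rcases cmap_eq hj hq g2 with e3 | ⟨e3, e4⟩
    · exact h1 ⟨rfl, e3⟩
    · exact key i j q e3 e4 (fun h => h1 ⟨rfl, h⟩) hij hpq
  · rcases cmap_eq hj hq g2 with e3 | ⟨e3, e4⟩
    · subst e3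
      exact key j i p e1 e2 (fun h => h1 ⟨h, rfl⟩) (sw _ _ hij) (sw _ _ hpq)
    · apply hc
      unfold cmap
      rw [if_pos e1, if_pos e3]

theorem contr_step {G : SimpleGraph ℕ} {V : Finset ℕ} {C : Finset (Sym2 ℕ)} {u v w p q x : ℕ}
    (hG : IsMopCycle G V C) (hV : 4 ≤ V.card) (hpq : s(p, q) ∈ C) (hw : w ∉ V) (hx : x ∉ V)
    (hxw : x ≠ w) (huv : s(u, v) ∈ C) (hne : s(u, v) ≠ s(p, q)) (ih : ContrGood G V C u v x) :
    ContrGood (SimpleGraph.fromEdgeSet (insert s(p, w) (insert s(q, w) G.edgeSet)))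
      (insert w V) (insert s(p, w) (insert s(q, w) (C.erase s(p, q)))) u v x := by
  obtain ⟨C', hC', hsub⟩ := ih
  obtain ⟨b1, b2⟩ := mop_basic hG
  have mp := b2 p q (b1 p q hpq)
  have mu := b2 u v (b1 u v huv)
  have np := (b1 p q hpq).ne
  have nu := (b1 u v huv).ne
  have nt : ∀ a b c, s(a, b) ∈ C → s(b, c) ∈ C → s(a, c) ∈ C → False := by
    intro a b c h1 h2 h3
    have := (mop_no_triangle hG a b c h1 h2 h3).1
    have h4 : ({a, b, c} : Finset ℕ).card ≤ 3 := Finset.card_le_three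
    rw [← this] at h4; omega
  have hcpq : cmap u v x p ≠ cmap u v x q := by
    simp only [ne_eq, Sym2.eq_iff] at hne
    unfold cmap; grind
  have hcw : cmap u v x w = w := by unfold cmap; grind
  refine ⟨_, mop_grow_ext _ _ w hC' (hsub p q hpq hcpq) (by grind) _ _ ?_ ?_, ?_⟩
  · intro i j
    simp only [contractEdge, fromRel_adj, fromEdgeSet_adj, Set.mem_insert_iff,
        mem_edgeSet, Sym2.eq_iff]
    have e1 := b2 w i
    have e2 := b2 w j
    have e3 := b2 u w
    have e4 := b2 v w
    have d3 : G.Adj i j → i ≠ j := fun h => h.ne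
    have d4 : G.Adj u i → u ≠ i := fun h => h.ne
    have d5 : G.Adj v i → v ≠ i := fun h => h.ne
    have d6 : G.Adj u j → u ≠ j := fun h => h.ne
    have d7 : G.Adj v j → v ≠ j := fun h => h.ne
    have d8 := G.adj_comm i j
    clear b1 b2 nt hsub hC' 
    simp only [ne_eq, Sym2.eq_iff] at hne
    unfold cmap at *
    by_cases hi : i = w
    · grind
    · by_cases hj : j = w
      · grind
      · grind
  · intro i
    simp only [Finset.mem_insert, Finset.mem_sdiff, Finset.mem_singleton]
    grind
  · intro i j hij hc
    simp only [Finset.mem_insert, Finset.mem_erase] at hij ⊢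
    rcases hij with h | h | ⟨h1, h2⟩
    · left
      have := congrArg (Sym2.map (cmap u v x)) h
      simpa [hcw] using this
    · right; left
      have := congrArg (Sym2.map (cmap u v x)) h
      simpa [hcw] using this
    · right; right
      refine ⟨?_, hsub i j h2 hc⟩
      intro heq
      have mi := b2 i j (b1 i j h2)
      have sw : ∀ a b, s(a, b) ∈ C → s(b, a) ∈ C := fun a b h => by rwa [Sym2.eq_swap]
      simp only [ne_eq, Sym2.eq_iff, not_or] at heq h1
      rcases heq with ⟨g1, g2⟩ | ⟨g1, g2⟩
      · exact cmap_inj_aux (fun a b => s(a, b) ∈ C) sw nt huv hpq h2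
          (by grind) (by grind) (by grind) (by grind) h1.1 hc g1 g2
      · exact cmap_inj_aux (fun a b => s(a, b) ∈ C) sw nt huv (sw _ _ hpq) h2
          (by grind) (by grind) (by grind) (by grind) h1.2 hc g1 g2

theorem mop_contr {G : SimpleGraph ℕ} {V : Finset ℕ} {C : Finset (Sym2 ℕ)}
    (h : IsMopCycle G V C) : 4 ≤ V.card → ∀ u v, s(u, v) ∈ C → ∀ x, x ∉ V →
    ContrGood G V C u v x := by
  induction h with
  | triangle a b c hab hac hbc =>
    intro h
    have h4 : ({a, b, c} : Finset ℕ).card ≤ 3 := Finset.card_le_three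
    omega
  | grow G V C p q w hG hpq hw ih =>
    intro _ u v huv x hx
    simp only [Finset.mem_insert, not_or] at hx
    obtain ⟨hxw, hx⟩ := hx
    have hqp : s(q, p) ∈ C := by rwa [Sym2.eq_swap]
    have hP := contr_ear hG hpq hw hx hxw
    have hQ := grow_swap _ _ _ _ _ _ _ _ _ (contr_ear hG hqp hw hx hxw)
    simp only [Finset.mem_insert, Finset.mem_erase] at huv
    rcases huv with h | h | ⟨h1, h2⟩
    · rcases Sym2.eq_iff.1 h with ⟨rfl, rfl⟩ | ⟨rfl, rfl⟩
      · exact hP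
      · exact hP.symm
    · rcases Sym2.eq_iff.1 h with ⟨rfl, rfl⟩ | ⟨rfl, rfl⟩
      · exact hQ
      · exact hQ.symm
    · by_cases hc : 4 ≤ V.card
      · exact contr_step hG hc hpq hw hx hxw h2 h1 (ih hc u v h2 x hx)
      · cases hG with
        | triangle a b c hab hac hbc =>
          exact contr_tri hab hac hbc hw hx hxw hpq h2 h1 _ rfl
        | grow G V C p q w hG hpq hw' =>
          have := mop_card hG
          rw [Finset.card_insert_of_notMem (by assumption)] at hc
          omega

/-- **Lemma 7 (O'Rourke).** If `G` is a mop of order `n ≥ 4`, `e = uv` is a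
Hamiltonian edge of `G`, and `G'` is the edge contraction of `G` along `e`
(with new vertex `x`), then `G'` is a mop. -/
theorem mop_contract_hamiltonian_edge (G : SimpleGraph ℕ) (V : Finset ℕ)
    (C : Finset (Sym2 ℕ)) (h : IsMopCycle G V C) (hn : 4 ≤ V.card)
    (u v : ℕ) (he : s(u, v) ∈ C) (x : ℕ) (hx : x ∉ V) :
    IsMop (contractEdge G u v x) (insert x (V \ {u, v})) := by
  obtain ⟨C', h1, -⟩ := mop_contr h hn u v he x hx
  exact ⟨C', h1⟩
end

section
/- If G is a maximal outerplanar graph of order n ≥ 4, then the set V₂ of vertices of G of degree 2 is an independent set of G (no two vertices of V₂ are adjacent) and |V₂| ≤ n/2. -/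
open SimpleGraph

/-- `a` has at least three neighbours. -/
def HasThree (G : SimpleGraph ℕ) (a : ℕ) : Prop :=
  ∃ x y z, x ≠ y ∧ x ≠ z ∧ y ≠ z ∧ G.Adj a x ∧ G.Adj a y ∧ G.Adj a z

lemma HasThree.not_two {G : SimpleGraph ℕ} {a : ℕ} (h : HasThree G a) : degOf G a ≠ 2 := by
  obtain ⟨x, y, z, hxy, hxz, hyz, hx, hy, hz⟩ := h
  intro h2
  unfold degOf at h2
  obtain ⟨p, q, hpq, he⟩ := Set.ncard_eq_two.mp h2
  have h1 : x ∈ G.neighborSet a := hx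
  have h3 : y ∈ G.neighborSet a := hy
  have h4 : z ∈ G.neighborSet a := hz
  rw [he] at h1 h3 h4
  simp only [Set.mem_insert_iff, Set.mem_singleton_iff] at h1 h3 h4
  grind

structure MopInv (G : SimpleGraph ℕ) (V : Finset ℕ) (C : Finset (Sym2 ℕ)) : Prop where
  adjV : ∀ x y, G.Adj x y → x ∈ V ∧ y ∈ V
  cyc : ∀ x y, s(x, y) ∈ C → G.Adj x y
  two : ∀ x ∈ V, ∃ y z, y ≠ z ∧ s(x, y) ∈ C ∧ s(x, z) ∈ C
  card : C.card ≤ V.card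
  three : 4 ≤ V.card → ∀ a b, G.Adj a b → HasThree G a ∨ HasThree G b

lemma IsMopCycle.inv {G : SimpleGraph ℕ} {V : Finset ℕ} {C : Finset (Sym2 ℕ)}
    (h : IsMopCycle G V C) : MopInv G V C := by
  induction h with
  | triangle a b c hab hac hbc =>
    have hV : ({a, b, c} : Finset ℕ).card = 3 := Finset.card_eq_three.mpr
      ⟨a, b, c, hab, hac, hbc, rfl⟩
    refine ⟨?_, ?_, ?_, ?_, ?_⟩
    · intro x y hxy
      simp only [fromEdgeSet_adj, Set.mem_insert_iff, Set.mem_singleton_iff, Sym2.eq_iff] at hxy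
      simp only [Finset.mem_insert, Finset.mem_singleton]
      grind
    · intro x y hxy
      simp only [Finset.mem_insert, Finset.mem_singleton, Sym2.eq_iff] at hxy
      simp only [fromEdgeSet_adj, Set.mem_insert_iff, Set.mem_singleton_iff, Sym2.eq_iff]
      grind
    · intro x hx
      simp only [Finset.mem_insert, Finset.mem_singleton] at hx
      simp only [Finset.mem_insert, Finset.mem_singleton, Sym2.eq_iff]
      rcases hx with rfl | rfl | rfl
      · exact ⟨b, c, by grind⟩
      · exact ⟨a, c, by grind⟩
      · exact ⟨a, b, by grind⟩
    · rw [hV]; exact Finset.card_le_three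
    · intro h4; omega
  | grow G V C u v w hG huv hw ih =>
    have auv := ih.cyc u v huv
    have nuv := auv.ne
    obtain ⟨hu, hv⟩ := ih.adjV u v auv
    have huw : u ≠ w := by rintro rfl; exact hw hu
    have hvw : v ≠ w := by rintro rfl; exact hw hv
    have adj : ∀ x y, (SimpleGraph.fromEdgeSet
        (insert s(u, w) (insert s(v, w) G.edgeSet))).Adj x y ↔
        (G.Adj x y ∨ (x = u ∧ y = w) ∨ (x = w ∧ y = u) ∨ (x = v ∧ y = w) ∨ (x = w ∧ y = v)) := by
      intro x y
      simp only [fromEdgeSet_adj, Set.mem_insert_iff, SimpleGraph.mem_edgeSet, Sym2.eq_iff]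
      have := fun h : G.Adj x y => h.ne
      grind
    have memC : ∀ x y, s(x, y) ∈ insert s(u, w) (insert s(v, w) (C.erase s(u, v))) ↔
        ((x = u ∧ y = w) ∨ (x = w ∧ y = u) ∨ (x = v ∧ y = w) ∨ (x = w ∧ y = v) ∨
          (¬ ((x = u ∧ y = v) ∨ (x = v ∧ y = u)) ∧ s(x, y) ∈ C)) := by
      intro x y
      simp only [Finset.mem_insert, Finset.mem_erase, ne_eq, Sym2.eq_iff]
      tauto
    have inV : ∀ x y, s(x, y) ∈ C → x ∈ V ∧ y ∈ V := fun x y h => ih.adjV _ _ (ih.cyc _ _ h)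
    generalize SimpleGraph.fromEdgeSet
        (insert s(u, w) (insert s(v, w) G.edgeSet)) = G' at adj
    have mono : ∀ a, HasThree G a → HasThree G' a := by
      rintro a ⟨x, y, z, h1, h2, h3, h4, h5, h6⟩
      exact ⟨x, y, z, h1, h2, h3, (adj _ _).2 (.inl h4), (adj _ _).2 (.inl h5),
        (adj _ _).2 (.inl h6)⟩
    have key : ∀ a, a = u ∨ a = v → HasThree G' a := by
      intro a ha
      have haV : a ∈ V := by grind
      obtain ⟨y, z, hyz, hy, hz⟩ := ih.two a haV
      refine ⟨y, z, w, hyz, ?_, ?_, (adj _ _).2 (.inl (ih.cyc _ _ hy)),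
        (adj _ _).2 (.inl (ih.cyc _ _ hz)), (adj _ _).2 (by grind)⟩
      · rintro rfl; exact hw (inV _ _ hy).2
      · rintro rfl; exact hw (inV _ _ hz).2
    refine ⟨?_, ?_, ?_, ?_, ?_⟩
    · intro x y hxy
      have := ih.adjV x y
      rw [adj] at hxy
      simp only [Finset.mem_insert]
      grind
    · intro x y hxy
      have := ih.cyc x y
      rw [memC] at hxy
      rw [adj]
      grind
    · intro x hx
      simp only [memC]
      by_cases hxw : x = w
      · exact ⟨u, v, by grind⟩
      have hxV : x ∈ V := by simpa [hxw] using hx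
      obtain ⟨y, z, hyz, hy, hz⟩ := ih.two x hxV
      have hyw : y ≠ w := by rintro rfl; exact hw (inV _ _ hy).2
      have hzw : z ≠ w := by rintro rfl; exact hw (inV _ _ hz).2
      by_cases h1 : (x = u ∧ y = v) ∨ (x = v ∧ y = u)
      · exact ⟨w, z, by grind⟩
      by_cases h2 : (x = u ∧ z = v) ∨ (x = v ∧ z = u)
      · exact ⟨y, w, by grind⟩
      · exact ⟨y, z, by grind⟩
    · have h1 := Finset.card_insert_le s(u, w) (insert s(v, w) (C.erase s(u, v)))
      have h2 := Finset.card_insert_le s(v, w) (C.erase s(u, v))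
      have h3 := Finset.card_erase_add_one huv
      have h4 := ih.card
      rw [Finset.card_insert_of_notMem hw]
      omega
    · intro _ a b hab
      rcases (adj a b).1 hab with h | h | h | h | h
      · by_cases h4 : 4 ≤ V.card
        · exact (ih.three h4 a b h).imp (mono a) (mono b)
        · by_cases ha : a = u ∨ a = v
          · exact .inl (key a ha)
          by_cases hb : b = u ∨ b = v
          · exact .inr (key b hb)
          exfalso
          apply h4
          obtain ⟨haV, hbV⟩ := ih.adjV a b h
          have hne := h.ne
          have hs : ({a, b, u, v} : Finset ℕ) ⊆ V := by
            intro t ht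
            simp only [Finset.mem_insert, Finset.mem_singleton] at ht
            grind
          have hc : ({a, b, u, v} : Finset ℕ).card = 4 := by
            push Not at ha hb
            simp [*]
          have := Finset.card_le_card hs
          omega
      · exact .inl (key a (.inl h.1))
      · exact .inr (key b (.inl h.2))
      · exact .inl (key a (.inr h.1))
      · exact .inr (key b (.inr h.2))

/-- **Lemma 8.** If `G` is a mop of order `n ≥ 4`, then the set of vertices of `G`
of degree `2` is an independent set of `G` of size at most `n / 2`. -/
theorem mop_deg_two_independent_and_le_half (G : SimpleGraph ℕ) (V : Finset ℕ)
    (hG : IsMop G V) (hn : 4 ≤ V.card) :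
    (∀ a ∈ V, ∀ b ∈ V, degOf G a = 2 → degOf G b = 2 → ¬ G.Adj a b) ∧
    (numDeg2 G V : ℚ) ≤ (V.card : ℚ) / 2 := by
  obtain ⟨C, hC⟩ := hG
  have I := hC.inv
  have ind : ∀ a ∈ V, ∀ b ∈ V, degOf G a = 2 → degOf G b = 2 → ¬ G.Adj a b := by
    intro a _ b _ h1 h2 hab
    rcases I.three hn a b hab with h | h
    · exact h.not_two h1
    · exact h.not_two h2
  refine ⟨ind, ?_⟩
  classical
  set S : Finset ℕ := V.filter (fun v => degOf G v = 2) with hS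
  have hnum : numDeg2 G V = S.card := by
    unfold numDeg2
    rw [← Set.ncard_coe_finset, hS, Finset.coe_filter]
    rfl
  have hdisj : ((S : Set ℕ)).PairwiseDisjoint (fun x => C.filter (fun e => x ∈ e)) := by
    intro x hx y hy hxy
    refine Finset.disjoint_left.2 ?_
    intro e he1 he2
    simp only [Finset.mem_filter] at he1 he2
    have he := (Sym2.mem_and_mem_iff hxy).1 ⟨he1.2, he2.2⟩
    subst he
    simp only [hS, Finset.coe_filter, Set.mem_ofPred_eq] at hx hy
    exact ind x hx.1 y hy.1 hx.2 hy.2 (I.cyc x y he1.1)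
  have hsub : S.biUnion (fun x => C.filter (fun e => x ∈ e)) ⊆ C := by
    intro e he
    simp only [Finset.mem_biUnion, Finset.mem_filter] at he
    obtain ⟨_, _, h, _⟩ := he
    exact h
  have h1 := Finset.card_le_card hsub
  rw [Finset.card_biUnion hdisj] at h1
  have h2 : S.card * 2 ≤ ∑ x ∈ S, (C.filter (fun e => x ∈ e)).card := by
    rw [← smul_eq_mul]
    refine Finset.card_nsmul_le_sum _ _ _ ?_
    intro x hx
    obtain ⟨y, z, hyz, hy, hz⟩ := I.two x (Finset.mem_filter.1 hx).1
    have : 1 < (C.filter (fun e => x ∈ e)).card := by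
      refine Finset.one_lt_card.2 ⟨s(x, y), by simp [hy], s(x, z), by simp [hz], ?_⟩
      rw [ne_eq, Sym2.eq_iff]
      grind
    exact this
  have h3 := I.card
  have h4 : S.card * 2 ≤ V.card := by omega
  rw [hnum, le_div_iff₀ (by norm_num)]
  exact_mod_cast h4
end

section
/- (Chvátal) If G is a maximal outerplanar graph of order n ≥ 3, then the domination number of G satisfies γ(G) ≤ n/3. -/
open SimpleGraph

/-- `S` is a dominating set of the graph `G` with vertex set `V`. -/
def IsDominating (G : SimpleGraph ℕ) (V : Finset ℕ) (S : Finset ℕ) : Prop :=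
  S ⊆ V ∧ ∀ v ∈ V, v ∉ S → ∃ u ∈ S, G.Adj u v

/-- The domination number `γ` of the graph `G` with vertex set `V`. -/
noncomputable def domNum (G : SimpleGraph ℕ) (V : Finset ℕ) : ℕ :=
  sInf {k | ∃ S : Finset ℕ, IsDominating G V S ∧ S.card = k}

theorem mop_exists_coloring {G : SimpleGraph ℕ} {V : Finset ℕ} {C : Finset (Sym2 ℕ)}
    (h : IsMopCycle G V C) :
    ∃ c : ℕ → Fin 3, (∀ u v, s(u, v) ∈ C → u ∈ V ∧ v ∈ V ∧ c u ≠ c v) ∧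
      ∀ v ∈ V, ∀ i, ∃ u ∈ V, c u = i ∧ (u = v ∨ G.Adj u v) := by
  induction h with
  | triangle a b c hab hac hbc =>
    refine ⟨fun x => if x = a then 0 else if x = b then 1 else 2, ?_, ?_⟩
    · intro u v huv
      simp only [Finset.mem_insert, Finset.mem_singleton, Sym2.eq_iff] at huv
      rcases huv with (⟨rfl, rfl⟩ | ⟨rfl, rfl⟩) | (⟨rfl, rfl⟩ | ⟨rfl, rfl⟩) | ⟨rfl, rfl⟩ | ⟨rfl, rfl⟩ <;>
        simp [hab, hac, hbc, hab.symm, hac.symm, hbc.symm]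
    · have key : ∀ x ∈ ({a, b, c} : Finset ℕ), ∀ y ∈ ({a, b, c} : Finset ℕ), x = y ∨
          (SimpleGraph.fromEdgeSet {s(a, b), s(b, c), s(a, c)}).Adj x y := by
        intro x hx y hy
        simp only [Finset.mem_insert, Finset.mem_singleton] at hx hy
        simp only [SimpleGraph.fromEdgeSet_adj, Set.mem_insert_iff, Set.mem_singleton_iff,
          Sym2.eq_iff]
        grind
      intro v hv i
      fin_cases i
      · exact ⟨a, by simp, by simp, key _ (by simp) _ hv⟩
      · exact ⟨b, by simp, by simp [hab.symm], key _ (by simp) _ hv⟩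
      · exact ⟨c, by simp, by simp [hac.symm, hbc.symm], key _ (by simp) _ hv⟩
  | grow G V C u v w hG huv hw ih =>
    obtain ⟨c, h1, h2⟩ := ih
    obtain ⟨hu, hv, hne⟩ := h1 u v huv
    have huw : u ≠ w := fun h => hw (h ▸ hu)
    have hvw : v ≠ w := fun h => hw (h ▸ hv)
    obtain ⟨k, hk⟩ : ∃ k : Fin 3, k ≠ c u ∧ k ≠ c v ∧ ∀ i, i = k ∨ i = c u ∨ i = c v := by
      generalize c u = p at *
      generalize c v = q at *
      clear * - hne
      revert p q
      decide
    obtain ⟨k1, k2, k3⟩ := hk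
    refine ⟨Function.update c w k, ?_, ?_⟩
    · intro x y hxy
      simp only [Finset.mem_insert, Finset.mem_erase] at hxy
      rcases hxy with h | h | ⟨-, h⟩
      · rcases Sym2.eq_iff.1 h with ⟨rfl, rfl⟩ | ⟨rfl, rfl⟩ <;>
          simp [*, Function.update_apply, k1.symm]
      · rcases Sym2.eq_iff.1 h with ⟨rfl, rfl⟩ | ⟨rfl, rfl⟩ <;>
          simp [*, Function.update_apply, k2.symm]
      · obtain ⟨hx, hy, hc⟩ := h1 x y h
        have hxw : x ≠ w := fun h => hw (h ▸ hx)
        have hyw : y ≠ w := fun h => hw (h ▸ hy)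
        simp [Function.update_apply, hx, hy, hc, hxw, hyw]
    · intro x hx i
      rcases Finset.mem_insert.1 hx with rfl | hx
      · rcases k3 i with rfl | rfl | rfl
        · exact ⟨x, by simp, by simp, Or.inl rfl⟩
        · exact ⟨u, by simp [hu], by simp [huw], Or.inr (by simp [huw])⟩
        · exact ⟨v, by simp [hv], by simp [hvw], Or.inr (by simp [hvw])⟩
      · obtain ⟨y, hy, hc, hd⟩ := h2 x hx i
        have hyw : y ≠ w := fun h => hw (h ▸ hy)
        refine ⟨y, by simp [hy], by simp [hyw, hc], hd.imp_right fun ha => ?_⟩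
        simp [ha, ha.ne]

/-- **Theorem 1(a) (Chvátal).** If `G` is a mop of order `n ≥ 3`, then
`γ(G) ≤ n / 3`. -/
theorem mop_domNum_le_card_div_three (G : SimpleGraph ℕ) (V : Finset ℕ)
    (hG : IsMop G V) (hn : 3 ≤ V.card) :
    (domNum G V : ℚ) ≤ (V.card : ℚ) / 3 := by
  obtain ⟨C, hC⟩ := hG
  obtain ⟨c, -, h2⟩ := mop_exists_coloring hC
  have hle : ∀ i : Fin 3, domNum G V ≤ (V.filter (fun x => c x = i)).card := by
    intro i
    refine Nat.sInf_le ⟨_, ⟨Finset.filter_subset _ _, ?_⟩, rfl⟩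
    intro v hv hvS
    obtain ⟨u, hu, hc, rfl | ha⟩ := h2 v hv i
    · exact absurd (Finset.mem_filter.2 ⟨hu, hc⟩) hvS
    · exact ⟨u, Finset.mem_filter.2 ⟨hu, hc⟩, ha⟩
  have hsum : V.card = ∑ i : Fin 3, (V.filter (fun x => c x = i)).card :=
    Finset.card_eq_sum_card_fiberwise (fun x _ => Finset.mem_coe.2 (Finset.mem_univ (c x)))
  rw [Fin.sum_univ_three] at hsum
  have h0 := hle 0
  have h1 := hle 1
  have h3 := hle 2
  have : domNum G V * 3 ≤ V.card := by omega
  rw [le_div_iff₀ (by norm_num)]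
  exact_mod_cast this
end

section
/- (Caro–Hansberg) If G is a maximal outerplanar graph of order n ≥ 4, then the K_{1,1}-isolation number of G satisfies ι₀(G) ≤ n/4. -/
open SimpleGraph

/-- `S` is a `K_{1,1}`-isolating set of the graph `G` with vertex set `V`:
`S ⊆ V` and `G − N[S]` contains no edge. -/
def IsIsolating11 (G : SimpleGraph ℕ) (V : Finset ℕ) (S : Finset ℕ) : Prop :=
  S ⊆ V ∧ ∀ x y : ℕ, x ∈ V → y ∈ V →
    x ∉ closedNbhd G S → y ∉ closedNbhd G S → ¬ G.Adj x y

/-- The `K_{1,1}`-isolation number `ι₀` of the graph `G` with vertex set `V`. -/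
noncomputable def iota0 (G : SimpleGraph ℕ) (V : Finset ℕ) : ℕ :=
  sInf {k | ∃ S : Finset ℕ, IsIsolating11 G V S ∧ S.card = k}


/-- Every edge sees every colour in its closed neighbourhood. -/
def EdgeSees (G : SimpleGraph ℕ) (V : Finset ℕ) (f : ℕ → Fin 4) : Prop :=
  ∀ a b, G.Adj a b → ∀ c, ∃ z ∈ V, f z = c ∧ (z = a ∨ z = b ∨ G.Adj a z ∨ G.Adj b z)

/-- Four pairwise distinct colours exhaust `Fin 4`. -/
lemma fin4_all (p q r s : Fin 4) (h1 : p ≠ q) (h2 : p ≠ r) (h3 : q ≠ r)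
    (h4 : s ≠ p) (h5 : s ≠ q) (h6 : s ≠ r) (c : Fin 4) : c = p ∨ c = q ∨ c = r ∨ c = s := by
  revert p q r s c; decide

/-- There is a fourth colour. -/
lemma fin4_new (p q r : Fin 4) : ∃ s, s ≠ p ∧ s ≠ q ∧ s ≠ r := by
  revert p q r; decide

/-- Colour greedily so that any two adjacent triangles carry all four colours. -/
lemma mop_coloring (G : SimpleGraph ℕ) (V : Finset ℕ) (C : Finset (Sym2 ℕ))
    (h : IsMopCycle G V C) :
    ∃ f : ℕ → Fin 4,
      (∀ a b, G.Adj a b → a ∈ V ∧ b ∈ V) ∧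
      (∀ u v, s(u, v) ∈ C → ∃ x ∈ V, G.Adj u v ∧ G.Adj u x ∧ G.Adj v x ∧
        f u ≠ f v ∧ f u ≠ f x ∧ f v ≠ f x) ∧
      ((V.card ≤ 3 ∧ ∀ u v, s(u, v) ∈ C → ∀ a b, G.Adj a b → a = u ∨ a = v ∨ b = u ∨ b = v) ∨
        EdgeSees G V f) := by
  induction h with
  | triangle a b c hab hac hbc =>
    refine ⟨fun n => if n = a then 0 else if n = b then 1 else 2, ?_, ?_, Or.inl ⟨?_, ?_⟩⟩
    · intro x y hxy
      simp only [fromEdgeSet_adj, Set.mem_insert_iff, Set.mem_singleton_iff, Sym2.eq_iff] at hxy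
      simp only [Finset.mem_insert, Finset.mem_singleton]
      grind
    · intro u v huv
      simp only [Finset.mem_insert, Finset.mem_singleton, Sym2.eq_iff] at huv
      simp only [fromEdgeSet_adj, Set.mem_insert_iff, Set.mem_singleton_iff, Sym2.eq_iff,
        Finset.mem_insert, Finset.mem_singleton]
      rcases huv with (⟨rfl, rfl⟩ | ⟨rfl, rfl⟩) | (⟨rfl, rfl⟩ | ⟨rfl, rfl⟩) | (⟨rfl, rfl⟩ | ⟨rfl, rfl⟩)
      · exact ⟨c, by simp_all [eq_comm]⟩
      · exact ⟨c, by simp_all [eq_comm]⟩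
      · exact ⟨a, by simp_all [eq_comm]⟩
      · exact ⟨a, by simp_all [eq_comm]⟩
      · exact ⟨b, by simp_all [eq_comm]⟩
      · exact ⟨b, by simp_all [eq_comm]⟩
    · exact Finset.card_le_three
    · intro u v huv x y hxy
      simp only [Finset.mem_insert, Finset.mem_singleton, Sym2.eq_iff] at huv
      simp only [fromEdgeSet_adj, Set.mem_insert_iff, Set.mem_singleton_iff, Sym2.eq_iff] at hxy
      grind
  | grow G V C u v w hG huv hw ih =>
    obtain ⟨f, hV, hC, hE⟩ := ih
    obtain ⟨x, hxV, auv, aux, avx, c1, c2, c3⟩ := hC u v huv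
    obtain ⟨s, s1, s2, s3⟩ := fin4_new (f u) (f v) (f x)
    have huV := (hV u v auv).1
    have hvV := (hV u v auv).2
    have huw : u ≠ w := fun h => hw (h ▸ huV)
    have hvw : v ≠ w := fun h => hw (h ▸ hvV)
    have hxw : x ≠ w := fun h => hw (h ▸ hxV)
    set G' := SimpleGraph.fromEdgeSet (insert s(u, w) (insert s(v, w) G.edgeSet)) with hG'
    have adj' : ∀ a b, G'.Adj a b ↔
        (((a = u ∧ b = w) ∨ (a = w ∧ b = u)) ∨ ((a = v ∧ b = w) ∨ (a = w ∧ b = v)) ∨ G.Adj a b) := by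
      intro a b
      simp only [hG', fromEdgeSet_adj, Set.mem_insert_iff, Sym2.eq_iff, mem_edgeSet]
      constructor
      · exact fun h => h.1
      · intro h
        refine ⟨h, ?_⟩
        rcases h with (⟨rfl, rfl⟩ | ⟨rfl, rfl⟩) | (⟨rfl, rfl⟩ | ⟨rfl, rfl⟩) | h
        · exact huw
        · exact huw.symm
        · exact hvw
        · exact hvw.symm
        · exact h.ne
    have up : ∀ z, z ≠ w → Function.update f w s z = f z := fun z hz => by simp [hz]
    have upw : Function.update f w s w = s := by simp
    have mono : ∀ a b, G.Adj a b → G'.Adj a b := fun a b h => (adj' a b).2 (Or.inr (Or.inr h))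
    have ruw : G'.Adj u w := (adj' u w).2 (by simp)
    have rvw : G'.Adj v w := (adj' v w).2 (by simp)
    -- any edge touching `u` or `v` sees all colours
    have key : ∀ t, t = u ∨ t = v → ∀ c, ∃ z ∈ insert w V, Function.update f w s z = c ∧
        (z = t ∨ G'.Adj t z) := by
      intro t ht c
      rcases fin4_all _ _ _ _ c1 c2 c3 s1 s2 s3 c with h | h | h | h
      · refine ⟨u, by simp [huV], by rw [up u huw, h], ?_⟩
        rcases ht with rfl | rfl
        · exact Or.inl rfl
        · exact Or.inr (mono _ _ auv.symm)
      · refine ⟨v, by simp [hvV], by rw [up v hvw, h], ?_⟩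
        rcases ht with rfl | rfl
        · exact Or.inr (mono _ _ auv)
        · exact Or.inl rfl
      · refine ⟨x, by simp [hxV], by rw [up x hxw, h], ?_⟩
        rcases ht with rfl | rfl
        · exact Or.inr (mono _ _ aux)
        · exact Or.inr (mono _ _ avx)
      · refine ⟨w, by simp, by rw [upw, h], ?_⟩
        rcases ht with rfl | rfl
        · exact Or.inr ruw
        · exact Or.inr rvw
    refine ⟨Function.update f w s, ?_, ?_, Or.inr ?_⟩
    · intro a b hab
      rw [adj'] at hab
      simp only [Finset.mem_insert]
      rcases hab with (⟨rfl, rfl⟩ | ⟨rfl, rfl⟩) | (⟨rfl, rfl⟩ | ⟨rfl, rfl⟩) | h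
      · simp [huV]
      · simp [huV]
      · simp [hvV]
      · simp [hvV]
      · exact ⟨Or.inr (hV _ _ h).1, Or.inr (hV _ _ h).2⟩
    · intro a b hab
      simp only [Finset.mem_insert, Finset.mem_erase, Sym2.eq_iff] at hab
      rcases hab with (⟨rfl, rfl⟩ | ⟨rfl, rfl⟩) | (⟨rfl, rfl⟩ | ⟨rfl, rfl⟩) | ⟨-, h⟩
      · refine ⟨v, by simp [hvV], ruw, mono _ _ auv, rvw.symm, ?_⟩
        rw [up _ huw, up _ hvw, upw]; exact ⟨s1.symm, c1, s2⟩
      · refine ⟨v, by simp [hvV], ruw.symm, rvw.symm, mono _ _ auv, ?_⟩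
        rw [up _ huw, up _ hvw, upw]; exact ⟨s1, s2, c1⟩
      · refine ⟨u, by simp [huV], rvw, mono _ _ auv.symm, ruw.symm, ?_⟩
        rw [up _ huw, up _ hvw, upw]; exact ⟨s2.symm, c1.symm, s1⟩
      · refine ⟨u, by simp [huV], rvw.symm, ruw.symm, mono _ _ auv.symm, ?_⟩
        rw [up _ huw, up _ hvw, upw]; exact ⟨s2, s1, c1.symm⟩
      · obtain ⟨y, hy, k1, k2, k3, k4⟩ := hC a b h
        have ha : a ≠ w := fun h => hw (h ▸ (hV _ _ k1).1)
        have hb : b ≠ w := fun h => hw (h ▸ (hV _ _ k1).2)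
        have hyw : y ≠ w := fun h => hw (h ▸ hy)
        refine ⟨y, by simp [hy], mono _ _ k1, mono _ _ k2, mono _ _ k3, ?_⟩
        rw [up _ ha, up _ hb, up _ hyw]; exact k4
    · intro a b hab c
      by_cases ha : a = u ∨ a = v
      · obtain ⟨z, hz, h1, h2⟩ := key a ha c
        exact ⟨z, hz, h1, by tauto⟩
      by_cases hb : b = u ∨ b = v
      · obtain ⟨z, hz, h1, h2⟩ := key b hb c
        exact ⟨z, hz, h1, by tauto⟩
      have hab' : G.Adj a b := by
        rw [adj'] at hab; tauto
      rcases hE with ⟨-, h⟩ | h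
      · have := h u v huv a b hab'
        tauto
      · obtain ⟨z, hz, h1, h2⟩ := h a b hab' c
        have hzw : z ≠ w := fun h => hw (h ▸ hz)
        refine ⟨z, by simp [hz], by rw [up z hzw, h1], ?_⟩
        rcases h2 with h2 | h2 | h2 | h2
        · exact Or.inl h2
        · exact Or.inr (Or.inl h2)
        · exact Or.inr (Or.inr (Or.inl (mono _ _ h2)))
        · exact Or.inr (Or.inr (Or.inr (mono _ _ h2)))

/-- **Theorem 1(b) (Caro–Hansberg).** If `G` is a mop of order `n ≥ 4`, then
`ι₀(G) ≤ n / 4`. -/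
theorem mop_iota0_le_card_div_four (G : SimpleGraph ℕ) (V : Finset ℕ)
    (hG : IsMop G V) (hn : 4 ≤ V.card) :
    (iota0 G V : ℚ) ≤ (V.card : ℚ) / 4 := by
  obtain ⟨C, hC⟩ := hG
  obtain ⟨f, -, -, h | hE⟩ := mop_coloring G V C hC
  · omega
  have hiso : ∀ c, iota0 G V ≤ (V.filter (fun z => f z = c)).card := by
    intro c
    apply Nat.sInf_le
    refine ⟨_, ⟨Finset.filter_subset _ _, ?_⟩, rfl⟩
    intro x y _ _ hx hy hxy
    obtain ⟨z, hz, h1, h2⟩ := hE x y hxy c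
    have hzS : z ∈ V.filter (fun z => f z = c) := by simp [hz, h1]
    rcases h2 with rfl | rfl | h2 | h2
    · exact hx (Or.inl hzS)
    · exact hy (Or.inl hzS)
    · exact hx (Or.inr ⟨z, hzS, h2.symm⟩)
    · exact hy (Or.inr ⟨z, hzS, h2.symm⟩)
  have hsum : V.card = ∑ c : Fin 4, (V.filter (fun z => f z = c)).card :=
    Finset.card_eq_sum_card_fiberwise (fun _ _ => by simp)
  have h4 : 4 * iota0 G V ≤ V.card := by
    rw [hsum, Fin.sum_univ_four]
    have := hiso 0
    have := hiso 1
    have := hiso 2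
    have := hiso 3
    omega
  have : (4 : ℚ) * iota0 G V ≤ V.card := by exact_mod_cast h4
  linarith
end

section
/- For every integer t ≥ 2 there exists a maximal outerplanar graph G of order n = 5t having exactly t vertices of degree 2 such that the K_{1,2}-isolation number of G satisfies ι₁(G) = t; in particular, ι₁(G) = n/5 and ι₁(G) = (n + n₂)/6 where n₂ is the number of vertices of degree 2, so the bounds ι₁(G) ≤ n/5 and ι₁(G) ≤ (n + n₂)/6 are sharp. -/
open SimpleGraph

/-- The graph obtained from `G` by joining `w` to `u` and `v`. -/
def growG (G : SimpleGraph ℕ) (u v w : ℕ) : SimpleGraph ℕ :=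
  SimpleGraph.fromEdgeSet (insert s(u, w) (insert s(v, w) G.edgeSet))

lemma growG_adj (G : SimpleGraph ℕ) {u v w : ℕ} (hu : u ≠ w) (hv : v ≠ w) (a b : ℕ) :
    (growG G u v w).Adj a b ↔ (a = u ∧ b = w) ∨ (a = w ∧ b = u) ∨ (a = v ∧ b = w) ∨
      (a = w ∧ b = v) ∨ G.Adj a b := by
  unfold growG
  simp only [fromEdgeSet_adj, Set.mem_insert_iff, mem_edgeSet, Sym2.eq_iff]
  constructor
  · tauto
  · intro h
    refine ⟨by tauto, ?_⟩
    rcases h with ⟨rfl, rfl⟩ | ⟨rfl, rfl⟩ | ⟨rfl, rfl⟩ | ⟨rfl, rfl⟩ | h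
    · exact hu
    · exact hu.symm
    · exact hv
    · exact hv.symm
    · exact h.ne

/-- The invariants of the construction with `m + 1` blocks. -/
structure BlockInv (m : ℕ) (G : SimpleGraph ℕ) : Prop where
  bd : ∀ a b, G.Adj a b → a < 5 * m + 5
  z : ∀ i ≤ m, ∀ w, G.Adj (5 * i + 4) w ↔ w = 5 * i + 2 ∨ w = 5 * i + 3
  y : ∀ i ≤ m, ∀ w, G.Adj (5 * i + 3) w ↔ w = 5 * i + 1 ∨ w = 5 * i + 2 ∨ w = 5 * i + 4
  x : ∀ i ≤ m, ∀ w, G.Adj (5 * i + 2) w ↔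
    w = 5 * i ∨ w = 5 * i + 1 ∨ w = 5 * i + 3 ∨ w = 5 * i + 4
  q : ∀ i ≤ m, G.Adj (5 * i + 1) (5 * i)
  p : ∀ i, i + 1 ≤ m → G.Adj (5 * (i + 1)) (5 * i)

lemma base_ok : ∃ G C, IsMopCycle G (Finset.range 5) C ∧ s(0, 1) ∈ C ∧ BlockInv 0 G := by
  have h0 := IsMopCycle.triangle 0 1 2 (by decide) (by decide) (by decide)
  have h1 := IsMopCycle.grow _ _ _ 1 2 3 h0 (by decide) (by decide)
  have h2 := IsMopCycle.grow _ _ _ 2 3 4 h1 (by decide) (by decide)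
  have hV : (insert 4 (insert 3 {0, 1, 2}) : Finset ℕ) = Finset.range 5 := by decide
  rw [hV] at h2
  refine ⟨_, _, h2, by decide, ?_⟩
  change BlockInv 0 (growG (growG _ 1 2 3) 2 3 4)
  have key : ∀ a b, (growG (growG (fromEdgeSet {s(0, 1), s(1, 2), s(0, 2)}) 1 2 3) 2 3 4).Adj a b ↔
      (a = 2 ∧ b = 4) ∨ (a = 4 ∧ b = 2) ∨ (a = 3 ∧ b = 4) ∨ (a = 4 ∧ b = 3) ∨
      (a = 1 ∧ b = 3) ∨ (a = 3 ∧ b = 1) ∨ (a = 2 ∧ b = 3) ∨ (a = 3 ∧ b = 2) ∨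
      (a = 0 ∧ b = 1) ∨ (a = 1 ∧ b = 0) ∨ (a = 1 ∧ b = 2) ∨ (a = 2 ∧ b = 1) ∨
      (a = 0 ∧ b = 2) ∨ (a = 2 ∧ b = 0) := by
    intro a b
    rw [growG_adj _ (by decide) (by decide), growG_adj _ (by decide) (by decide)]
    simp only [fromEdgeSet_adj, Set.mem_insert_iff, Set.mem_singleton_iff, Sym2.eq_iff]
    grind
  clear h0 h1 h2 hV
  constructor
  · intro a b hab
    rw [key] at hab
    omega
  · intro i hi w
    obtain rfl : i = 0 := by omega
    simp [key]
  · intro i hi w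
    obtain rfl : i = 0 := by omega
    simp [key]
    omega
  · intro i hi w
    obtain rfl : i = 0 := by omega
    simp [key]
    omega
  · intro i hi
    obtain rfl : i = 0 := by omega
    simp [key]
  · intro i hi
    omega

set_option maxHeartbeats 1000000 in
lemma step_ok (m : ℕ) (G : SimpleGraph ℕ) (C : Finset (Sym2 ℕ))
    (h : IsMopCycle G (Finset.range (5 * m + 5)) C) (he : s(5 * m, 1) ∈ C) (hI : BlockInv m G) :
    ∃ G' C', IsMopCycle G' (Finset.range (5 * (m + 1) + 5)) C' ∧ s(5 * (m + 1), 1) ∈ C' ∧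
      BlockInv (m + 1) G' := by
  obtain ⟨n, hn⟩ : ∃ n, n = 5 * m + 5 := ⟨_, rfl⟩
  have h1 := IsMopCycle.grow _ _ _ (5 * m) 1 (n + 0) h he (by simp; omega)
  have h2 := IsMopCycle.grow _ _ _ (5 * m) n (n + 1) h1
    (by simp) (by simp; omega)
  have h3 := IsMopCycle.grow _ _ _ n (n + 1) (n + 2) h2
    (by simp) (by simp; omega)
  have h4 := IsMopCycle.grow _ _ _ (n + 1) (n + 2) (n + 3) h3
    (by simp) (by simp; omega)
  have h5 := IsMopCycle.grow _ _ _ (n + 2) (n + 3) (n + 4) h4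
    (by simp) (by simp; omega)
  have hV : (insert (n + 4) (insert (n + 3) (insert (n + 2) (insert (n + 1) (insert (n + 0)
      (Finset.range (5 * m + 5)))))) : Finset ℕ) = Finset.range (5 * (m + 1) + 5) := by
    ext a
    simp only [Finset.mem_insert, Finset.mem_range]
    omega
  rw [hV] at h5
  refine ⟨_, _, h5, ?_, ?_⟩
  · have go : ∀ (D : Finset (Sym2 ℕ)) (a b : ℕ) (e f : Sym2 ℕ), a ≠ 1 → b ≠ 1 →
        s(5 * (m + 1), 1) ∈ D → s(5 * (m + 1), 1) ∈ insert e (insert f (D.erase s(a, b))) := by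
      intro D a b e f ha hb hD
      refine Finset.mem_insert_of_mem (Finset.mem_insert_of_mem (Finset.mem_erase.2 ⟨?_, hD⟩))
      intro hs
      rw [Sym2.eq_iff] at hs
      omega
    refine go _ _ _ _ _ (by omega) (by omega) (go _ _ _ _ _ (by omega) (by omega)
      (go _ _ _ _ _ (by omega) (by omega) (go _ _ _ _ _ (by omega) (by omega) ?_)))
    refine Finset.mem_insert_of_mem (Finset.mem_insert.2 (Or.inl ?_))
    rw [Sym2.eq_iff]
    omega
  change BlockInv (m + 1) (growG (growG (growG (growG (growG G (5 * m) 1 (n + 0)) (5 * m) n (n + 1))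
    n (n + 1) (n + 2)) (n + 1) (n + 2) (n + 3)) (n + 2) (n + 3) (n + 4))
  have key := fun a b => (growG_adj (growG (growG (growG (growG G (5 * m) 1 (n + 0)) (5 * m) n
    (n + 1)) n (n + 1) (n + 2)) (n + 1) (n + 2) (n + 3)) (u := n + 2) (v := n + 3) (w := n + 4)
    (by omega) (by omega) a b)
  simp only [growG_adj _ (show n + 1 ≠ n + 3 by omega) (show n + 2 ≠ n + 3 by omega),
    growG_adj _ (show n ≠ n + 2 by omega) (show n + 1 ≠ n + 2 by omega),
    growG_adj _ (show 5 * m ≠ n + 1 by omega) (show n ≠ n + 1 by omega),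
    growG_adj _ (show 5 * m ≠ n + 0 by omega) (show 1 ≠ n + 0 by omega)] at key
  clear hV h5 h4 h3 h2 h1
  have b1 := hI.bd
  have b2 : ∀ a b, G.Adj a b → b < 5 * m + 5 := fun a b hab => b1 b a hab.symm
  constructor
  · intro a b hab
    rw [key] at hab
    have h1 := b1 a b
    by_cases hA : G.Adj a b
    · have := h1 hA
      omega
    · simp only [hA, or_false] at hab
      omega
  · intro i hi w
    rw [key]
    have h1 : m < i → ¬ G.Adj (5 * i + 4) w := by
      intro h hA
      have := b1 _ _ hA
      omega
    have h2 := hI.z i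
    rcases Nat.lt_or_ge m i with h | h
    · simp only [h1 h, or_false]
      clear h1 h2
      obtain rfl : i = m + 1 := by omega
      have e0 : 5 * (m + 1) = n := by omega
      have e1 : n + 4 ≠ 5 * m := by omega
      have e2 : n + 4 ≠ 1 := by omega
      simp only [e0]
      simp [e1]
      try grind
    · have h2 := h2 h w
      have e0 : ∀ k, 5 * i + 4 ≠ n + k := by omega
      have e3 : 5 * i + 4 ≠ n := by omega
      have e1 : 5 * i + 4 ≠ 5 * m := by omega
      have e2 : 5 * i + 4 ≠ 1 := by omega
      simp only [h2, e0, e1, e2, e3, false_and, false_or]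
  · intro i hi w
    rw [key]
    have h1 : m < i → ¬ G.Adj (5 * i + 3) w := by
      intro h hA
      have := b1 _ _ hA
      omega
    have h2 := hI.y i
    rcases Nat.lt_or_ge m i with h | h
    · simp only [h1 h, or_false]
      clear h1 h2
      obtain rfl : i = m + 1 := by omega
      have e0 : 5 * (m + 1) = n := by omega
      have e1 : n + 3 ≠ 5 * m := by omega
      have e2 : n + 3 ≠ 1 := by omega
      simp only [e0]
      simp [e1]
      try grind
    · have h2 := h2 h w
      have e0 : ∀ k, 5 * i + 3 ≠ n + k := by omega
      have e3 : 5 * i + 3 ≠ n := by omega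
      have e1 : 5 * i + 3 ≠ 5 * m := by omega
      have e2 : 5 * i + 3 ≠ 1 := by omega
      simp only [h2, e0, e1, e2, e3, false_and, false_or]
  · intro i hi w
    rw [key]
    have h1 : m < i → ¬ G.Adj (5 * i + 2) w := by
      intro h hA
      have := b1 _ _ hA
      omega
    have h2 := hI.x i
    rcases Nat.lt_or_ge m i with h | h
    · simp only [h1 h, or_false]
      clear h1 h2
      obtain rfl : i = m + 1 := by omega
      have e0 : 5 * (m + 1) = n := by omega
      have e1 : n + 2 ≠ 5 * m := by omega
      have e2 : n + 2 ≠ 1 := by omega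
      simp only [e0]
      simp [e1]
      try grind
    · have h2 := h2 h w
      have e0 : ∀ k, 5 * i + 2 ≠ n + k := by omega
      have e3 : 5 * i + 2 ≠ n := by omega
      have e1 : 5 * i + 2 ≠ 5 * m := by omega
      have e2 : 5 * i + 2 ≠ 1 := by omega
      simp only [h2, e0, e1, e2, e3, false_and, false_or]
  · intro i hi
    rw [key]
    rcases Nat.lt_or_ge m i with h | h
    · obtain rfl : i = m + 1 := by omega
      iterate 15 right
      left
      omega
    · have := hI.q i h
      simp only [this, or_true]
  · intro i hi
    rw [key]
    rcases Nat.lt_or_ge m (i + 1) with h | h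
    · obtain rfl : i = m := by omega
      iterate 17 right
      left
      omega
    · have := hI.p i h
      simp only [this, or_true]

lemma exists_ok (m : ℕ) : ∃ G C, IsMopCycle G (Finset.range (5 * m + 5)) C ∧ s(5 * m, 1) ∈ C ∧
    BlockInv m G := by
  induction m with
  | zero => exact base_ok
  | succ m ih =>
    obtain ⟨G, C, h, he, hI⟩ := ih
    exact step_ok m G C h he hI

lemma three_le_deg {m : ℕ} {G : SimpleGraph ℕ} (hI : BlockInv m G) {v a b c : ℕ} (ha : G.Adj v a)
    (hb : G.Adj v b) (hc : G.Adj v c) (hab : a ≠ b) (hac : a ≠ c) (hbc : b ≠ c) :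
    degOf G v ≠ 2 := by
  have hfin : (G.neighborSet v).Finite :=
    (Set.finite_Iio (5 * m + 5)).subset (fun w hw => hI.bd w v (G.adj_symm hw))
  have hsub : (({a, b, c} : Finset ℕ) : Set ℕ) ⊆ G.neighborSet v := by
    intro w hw
    simp at hw
    rcases hw with rfl | rfl | rfl <;> assumption
  have := Set.ncard_le_ncard hsub hfin
  rw [Set.ncard_coe_finset, Finset.card_eq_three.2 ⟨a, b, c, hab, hac, hbc, rfl⟩] at this
  unfold degOf
  omega

lemma numDeg2_eq {m : ℕ} (hm : 1 ≤ m) {G : SimpleGraph ℕ} (hI : BlockInv m G) :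
    numDeg2 G (Finset.range (5 * m + 5)) = m + 1 := by
  have hs : {v ∈ ((Finset.range (5 * m + 5) : Finset ℕ) : Set ℕ) | degOf G v = 2} =
      (((Finset.range (m + 1)).image (fun i => 5 * i + 4) : Finset ℕ) : Set ℕ) := by
    ext v
    simp only [Finset.coe_range, Set.mem_Iio, Set.mem_ofPred_eq, Finset.coe_image, Set.mem_image]
    constructor
    · rintro ⟨hv, hd⟩
      refine ⟨v / 5, by omega, ?_⟩
      by_contra hne
      obtain ⟨i, r, rfl, hr⟩ : ∃ i r, v = 5 * i + r ∧ r < 4 :=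
        ⟨v / 5, v % 5, by omega, by omega⟩
      have hi : i ≤ m := by omega
      have hx := hI.x i hi
      have hy := hI.y i hi
      have hq := hI.q i hi
      have ax := fun w h => ((hx w).2 h).symm
      have ay := fun w h => ((hy w).2 h).symm
      interval_cases r
      · rcases Nat.eq_zero_or_pos i with rfl | hpos
        · exact three_le_deg hI hq.symm (ax _ (by omega)) (hI.p 0 hm).symm
            (by omega) (by omega) (by omega) hd
        · obtain ⟨j, rfl⟩ : ∃ j, i = j + 1 := ⟨i - 1, by omega⟩
          exact three_le_deg hI hq.symm (ax _ (by omega)) (hI.p j hi)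
            (by omega) (by omega) (by omega) hd
      · exact three_le_deg hI hq (ax _ (by omega)) (ay _ (by omega))
          (by omega) (by omega) (by omega) hd
      · exact three_le_deg hI ((hx (5 * i)).2 (by omega)) ((hx (5 * i + 1)).2 (by omega))
          ((hx (5 * i + 3)).2 (by omega)) (by omega) (by omega) (by omega) hd
      · exact three_le_deg hI ((hy (5 * i + 1)).2 (by omega)) ((hy (5 * i + 2)).2 (by omega))
          ((hy (5 * i + 4)).2 (by omega)) (by omega) (by omega) (by omega) hd
    · rintro ⟨i, hi, rfl⟩
      refine ⟨by omega, ?_⟩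
      have : G.neighborSet (5 * i + 4) = {5 * i + 2, 5 * i + 3} := by
        ext w
        simp [hI.z i (by omega)]
      rw [degOf, this, Set.ncard_pair (by omega)]
  rw [numDeg2, hs, Set.ncard_coe_finset, Finset.card_image_of_injective, Finset.card_range]
  intro a b h
  simp only at h
  omega

lemma iota1_eq {m : ℕ} {G : SimpleGraph ℕ} (hI : BlockInv m G) :
    iota1 G (Finset.range (5 * m + 5)) = m + 1 := by
  apply le_antisymm
  · apply Nat.sInf_le
    refine ⟨(Finset.range (m + 1)).image (fun i => 5 * i + 2), ⟨?_, ?_⟩, ?_⟩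
    · intro v
      simp only [Finset.mem_image, Finset.mem_range]
      rintro ⟨i, hi, rfl⟩
      omega
    · intro x y z hx _ _ hx'
      exfalso
      apply hx'
      simp only [Finset.mem_range] at hx
      have hX := hI.x (x / 5) (by omega) x
      simp only [closedNbhd, Finset.mem_image, Finset.mem_range, Set.mem_ofPred_eq]
      by_cases h2 : x % 5 = 2
      · left
        exact ⟨x / 5, by omega, by omega⟩
      · right
        exact ⟨5 * (x / 5) + 2, ⟨x / 5, by omega, rfl⟩, hX.2 (by omega)⟩
    · rw [Finset.card_image_of_injective, Finset.card_range]
      intro a b h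
      simp only at h
      omega
  · apply le_csInf
    · exact ⟨_, Finset.range (5 * m + 5), ⟨subset_rfl, fun x y z hx _ _ hx' =>
        absurd (Or.inl hx) hx'⟩, rfl⟩
    · rintro k ⟨S, ⟨_, hS⟩, rfl⟩
      have hsub : Finset.range (m + 1) ⊆ S.image (fun v => v / 5) := by
        intro i hi
        simp only [Finset.mem_range] at hi
        by_contra hno
        simp only [Finset.mem_image, not_exists, not_and] at hno
        have hx := hI.x i (by omega)
        have hy := hI.y i (by omega)
        have hz := hI.z i (by omega)
        have nx : 5 * i + 2 ∉ closedNbhd G S := by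
          rintro (h | ⟨u, hu, ha⟩)
          · exact hno _ h (by omega)
          · have := (hx u).1 ha.symm
            exact hno _ hu (by omega)
        have ny : 5 * i + 3 ∉ closedNbhd G S := by
          rintro (h | ⟨u, hu, ha⟩)
          · exact hno _ h (by omega)
          · have := (hy u).1 ha.symm
            exact hno _ hu (by omega)
        have nz : 5 * i + 4 ∉ closedNbhd G S := by
          rintro (h | ⟨u, hu, ha⟩)
          · exact hno _ h (by omega)
          · have := (hz u).1 ha.symm
            exact hno _ hu (by omega)
        have := hS (5 * i + 2) (5 * i + 3) (5 * i + 4) (by simp; omega) (by simp; omega)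
          (by simp; omega) nx ny nz ((hx _).2 (by omega)) ((hx _).2 (by omega))
        omega
      have h1 := Finset.card_le_card hsub
      rw [Finset.card_range] at h1
      exact h1.trans Finset.card_image_le

/-- **Sharpness of the bounds `n/5` and `(n + n₂)/6`.** For every `t ≥ 2` there is a
mop `G` of order `n = 5t` with exactly `t` vertices of degree `2` such that
`ι₁(G) = t`; in particular `ι₁(G) = n/5` and `ι₁(G) = (n + n₂)/6`. -/
theorem mop_iota1_sharp_n_div_five (t : ℕ) (ht : 2 ≤ t) :
    ∃ (G : SimpleGraph ℕ) (V : Finset ℕ),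
      IsMop G V ∧ V.card = 5 * t ∧ numDeg2 G V = t ∧ iota1 G V = t ∧
      (iota1 G V : ℚ) = (V.card : ℚ) / 5 ∧
      (iota1 G V : ℚ) = ((V.card : ℚ) + (numDeg2 G V : ℚ)) / 6 := by
  obtain ⟨m, rfl⟩ : ∃ m, t = m + 1 := ⟨t - 1, by omega⟩
  obtain ⟨G, C, hC, -, hI⟩ := exists_ok m
  have h1 := numDeg2_eq (by omega) hI
  have h2 := iota1_eq hI
  refine ⟨G, Finset.range (5 * m + 5), ⟨C, hC⟩, ?_, h1, h2, ?_, ?_⟩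
  · rw [Finset.card_range]; ring
  · rw [h2, Finset.card_range]; push_cast; ring
  · rw [h1, h2, Finset.card_range]; push_cast; ring
end

section
/- For every integer t ≥ 2 there exists a maximal outerplanar graph G of order n = 5t having exactly n₂ = 2t vertices of degree 2 such that the K_{1,2}-isolation number of G satisfies ι₁(G) = t = (n − n₂)/3; hence the bound ι₁(G) ≤ (n − n₂)/3 (for mops with n₂ > n/3) is sharp. -/
open SimpleGraph

lemma grow_adj (G : SimpleGraph ℕ) (u v w x y : ℕ) :
    (SimpleGraph.fromEdgeSet (insert s(u, w) (insert s(v, w) G.edgeSet))).Adj x y ↔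
      ((x = u ∧ y = w ∨ x = w ∧ y = u) ∨ (x = v ∧ y = w ∨ x = w ∧ y = v) ∨ G.Adj x y)
        ∧ x ≠ y := by
  simp [SimpleGraph.fromEdgeSet_adj]

/-- The block structure of the extremal graphs. -/
def BlockGood (G : SimpleGraph ℕ) (t : ℕ) : Prop :=
  (∀ x y, G.Adj x y → x < 5 * t ∧ y < 5 * t) ∧
  ∀ i < t, G.Adj (5 * i) (5 * i + 1) ∧
    (∀ y, G.Adj (5 * i + 2) y ↔ y = 5 * i ∨ y = 5 * i + 1 ∨ y = 5 * i + 3 ∨ y = 5 * i + 4) ∧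
    (∀ y, G.Adj (5 * i + 3) y ↔ y = 5 * i ∨ y = 5 * i + 2) ∧
    (∀ y, G.Adj (5 * i + 4) y ↔ y = 5 * i + 1 ∨ y = 5 * i + 2)

set_option maxHeartbeats 1000000 in
lemma exists_block (t : ℕ) : ∃ (G : SimpleGraph ℕ) (C : Finset (Sym2 ℕ)),
    IsMopCycle G (Finset.range (5 * (t + 1))) C ∧ s(0, 5 * t + 1) ∈ C ∧
    BlockGood G (t + 1) := by
  induction t with
  | zero =>
    have h0 := IsMopCycle.triangle 0 1 2 (by decide) (by decide) (by decide)
    have h1 := IsMopCycle.grow _ _ _ 0 2 3 h0 (by decide) (by decide)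
    have h2 := IsMopCycle.grow _ _ _ 1 2 4 h1 (by decide) (by decide)
    have hV : (insert 4 (insert 3 {0, 1, 2}) : Finset ℕ) = Finset.range (5 * (0 + 1)) := by
      decide
    rw [hV] at h2
    refine ⟨_, _, h2, by decide, ?_⟩
    have hadj : ∀ x y, (SimpleGraph.fromEdgeSet
        ({s(0, 1), s(1, 2), s(0, 2)} : Set (Sym2 ℕ))).Adj x y ↔
        ((x = 0 ∧ y = 1 ∨ x = 1 ∧ y = 0) ∨ (x = 1 ∧ y = 2 ∨ x = 2 ∧ y = 1) ∨
        (x = 0 ∧ y = 2 ∨ x = 2 ∧ y = 0)) ∧ x ≠ y := by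
      intro x y; simp [SimpleGraph.fromEdgeSet_adj]
    unfold BlockGood
    simp only [grow_adj, hadj]
    refine ⟨by intro x y; omega, ?_⟩
    intro i hi
    obtain rfl : i = 0 := by omega
    refine ⟨by omega, ?_, ?_, ?_⟩ <;> intro y <;> omega
  | succ t ih =>
    obtain ⟨G, C, hG, hC, hP, hQ⟩ := ih
    obtain ⟨m, hm⟩ : ∃ m, m = 5 * (t + 1) := ⟨_, rfl⟩
    obtain ⟨p, hp⟩ : ∃ p, p = 5 * t + 1 := ⟨_, rfl⟩
    rw [← hm] at hG
    rw [← hp] at hC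
    have h1 := IsMopCycle.grow _ _ _ 0 p m hG hC (by simp)
    have h2 := IsMopCycle.grow _ _ _ 0 m (m+1) h1 (by simp) (by simp)
    have h3 := IsMopCycle.grow _ _ _ m (m+1) (m+2) h2 (by simp) (by simp)
    have h4 := IsMopCycle.grow _ _ _ m (m+2) (m+3) h3 (by simp) (by simp)
    have h5 := IsMopCycle.grow _ _ _ (m+1) (m+2) (m+4) h4 (by simp) (by simp)
    have hV : (insert (m+4) (insert (m+3) (insert (m+2) (insert (m+1) (insert m
        (Finset.range m))))) : Finset ℕ) = Finset.range (5 * (t + 1 + 1)) := by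
      ext x; simp; omega
    rw [hV] at h5
    refine ⟨_, _, h5, ?_, ?_⟩
    · have : 5 * (t + 1) + 1 = m + 1 := by omega
      rw [this]; simp; omega
    · unfold BlockGood
      simp only [grow_adj]
      refine ⟨?_, ?_⟩
      · intro x y h
        have := hP x y
        by_cases hxy : G.Adj x y
        · have := this hxy; omega
        · simp only [hxy, or_false] at h; omega
      · intro i hi
        rcases Nat.lt_or_ge i (t + 1) with h | h
        · obtain ⟨q1, q2, q3, q4⟩ := hQ i h
          refine ⟨?_, ?_, ?_, ?_⟩
          · simp [q1]
          all_goals intro y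
          · rw [q2]; omega
          · rw [q3]; omega
          · rw [q4]; omega
        · obtain rfl : i = t + 1 := by omega
          rw [← hm]
          have hn : ∀ k y, ¬ G.Adj (m + k) y := by
            intro k y h
            have := (hP _ _ h).1
            omega
          have hn0 : ∀ y, ¬ G.Adj m y := hn 0
          simp only [hn, hn0, or_false, true_and, and_true, true_or, or_true]
          have hm0 : m ≠ 0 := by omega
          have e : ∀ a b : ℕ, m + a = m + b ↔ a = b := by omega
          have e1 : ∀ a : ℕ, m = m + a ↔ a = 0 := by omega
          have e2 : ∀ a : ℕ, m + a = m ↔ a = 0 := by omega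
          have e3 : ∀ a : ℕ, m + a ≠ 0 := by omega
          have e4 : ∀ a : ℕ, m + a ≠ p := by omega
          have e5 : m ≠ p := by omega
          simp only [e, e1, e2, e3, e4, e5, hm0]
          norm_num
          clear h1 h2 h3 h4 h5 hV hQ hP hG hC
          intro y; omega

lemma block_deg {G : SimpleGraph ℕ} {t : ℕ} (h : BlockGood G t) (v : ℕ) (hv : v < 5 * t) :
    degOf G v = 2 ↔ v % 5 = 3 ∨ v % 5 = 4 := by
  obtain ⟨hP, hQ⟩ := h
  have hfin : ∀ v, (G.neighborSet v).Finite := fun v =>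
    (Set.finite_lt_nat (5 * t)).subset (fun y hy => (hP _ _ hy).2)
  have big : ∀ v a b c, a ≠ b → a ≠ c → b ≠ c → G.Adj v a → G.Adj v b → G.Adj v c →
      degOf G v ≠ 2 := by
    intro v a b c hab hac hbc ha hb hc
    have hsub : (({a, b, c} : Finset ℕ) : Set ℕ) ⊆ G.neighborSet v := by
      intro x hx
      simp at hx
      rcases hx with rfl | rfl | rfl <;> assumption
    have := Set.ncard_le_ncard hsub (hfin v)
    rw [Set.ncard_coe_finset, Finset.card_eq_three.2 ⟨a, b, c, hab, hac, hbc, rfl⟩] at this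
    unfold degOf
    omega
  obtain ⟨i, hi⟩ : ∃ i, i = v / 5 := ⟨_, rfl⟩
  obtain ⟨q1, q2, q3, q4⟩ := hQ i (by omega)
  have hr : v = 5 * i ∨ v = 5 * i + 1 ∨ v = 5 * i + 2 ∨ v = 5 * i + 3 ∨ v = 5 * i + 4 := by
    omega
  rcases hr with rfl | rfl | rfl | rfl | rfl
  · have := big (5 * i) (5 * i + 1) (5 * i + 2) (5 * i + 3) (by omega) (by omega) (by omega) q1
      ((q2 _).2 (by omega)).symm ((q3 _).2 (by omega)).symm
    simp only [this, false_iff]; omega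
  · have := big (5 * i + 1) (5 * i) (5 * i + 2) (5 * i + 4) (by omega) (by omega) (by omega)
      q1.symm ((q2 _).2 (by omega)).symm ((q4 _).2 (by omega)).symm
    simp only [this, false_iff]; omega
  · have := big (5 * i + 2) (5 * i) (5 * i + 1) (5 * i + 3) (by omega) (by omega) (by omega)
      ((q2 _).2 (by omega)) ((q2 _).2 (by omega)) ((q2 _).2 (by omega))
    simp only [this, false_iff]; omega
  · have : G.neighborSet (5 * i + 3) = {5 * i, 5 * i + 2} := by
      ext y; simp [q3]
    rw [degOf, this, Set.ncard_pair (by omega)]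
    simp
  · have : G.neighborSet (5 * i + 4) = {5 * i + 1, 5 * i + 2} := by
      ext y; simp [q4]
    rw [degOf, this, Set.ncard_pair (by omega)]
    simp

lemma block_numDeg2 {G : SimpleGraph ℕ} {t : ℕ} (h : BlockGood G t) :
    numDeg2 G (Finset.range (5 * t)) = 2 * t := by
  have hs : {v ∈ ((Finset.range (5 * t) : Finset ℕ) : Set ℕ) | degOf G v = 2} =
      (((Finset.range (2 * t)).image (fun j => 5 * (j / 2) + 3 + j % 2) : Finset ℕ) : Set ℕ) := by
    ext v
    simp only [Finset.coe_range, Set.mem_Iio, Set.mem_ofPred_eq, Finset.coe_image, Set.mem_image]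
    constructor
    · rintro ⟨h1, h2⟩
      rw [block_deg h v h1] at h2
      exact ⟨2 * (v / 5) + (v % 5 - 3), by omega, by omega⟩
    · rintro ⟨j, hj, rfl⟩
      have hlt : 5 * (j / 2) + 3 + j % 2 < 5 * t := by omega
      refine ⟨hlt, ?_⟩
      rw [block_deg h _ hlt]
      omega
  rw [numDeg2, hs, Set.ncard_coe_finset, Finset.card_image_of_injOn, Finset.card_range]
  intro a _ b _ hab
  simp only at hab
  omega

lemma block_iota {G : SimpleGraph ℕ} {t : ℕ} (h : BlockGood G t) :
    iota1 G (Finset.range (5 * t)) = t := by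
  obtain ⟨hP, hQ⟩ := h
  have hmem : t ∈ {k | ∃ S : Finset ℕ, IsIsolating12 G (Finset.range (5 * t)) S ∧ S.card = k} := by
    refine ⟨(Finset.range t).image (fun i => 5 * i + 2), ⟨?_, ?_⟩, ?_⟩
    · intro x hx
      simp only [Finset.mem_image, Finset.mem_range] at hx ⊢
      omega
    · intro x y z hx _ _ hx' _ _ _ _
      exfalso
      apply hx'
      simp only [Finset.mem_range] at hx
      have hmS : 5 * (x / 5) + 2 ∈ (Finset.range t).image (fun i => 5 * i + 2) :=
        Finset.mem_image.2 ⟨x / 5, Finset.mem_range.2 (by omega), rfl⟩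
      by_cases hx2 : x = 5 * (x / 5) + 2
      · left; rw [hx2]; exact hmS
      · right
        exact ⟨_, hmS, ((hQ (x / 5) (by omega)).2.1 x).2 (by omega)⟩
    · rw [Finset.card_image_of_injective, Finset.card_range]
      intro a b hab
      simp only at hab
      omega
  apply le_antisymm (Nat.sInf_le hmem)
  apply le_csInf ⟨t, hmem⟩
  rintro k ⟨S, ⟨hSV, hS⟩, rfl⟩
  have hsub : Finset.range t ⊆ S.image (fun x => x / 5) := by
    intro i hi
    rw [Finset.mem_range] at hi
    by_contra hno
    have hno' : ∀ x ∈ S, x / 5 ≠ i := fun x hx hxi => hno (Finset.mem_image.2 ⟨x, hx, hxi⟩)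
    obtain ⟨q1, q2, q3, q4⟩ := hQ i hi
    have key := hS (5 * i + 2) (5 * i + 3) (5 * i + 4) (by simp; omega) (by simp; omega)
      (by simp; omega) ?_ ?_ ?_ ((q2 _).2 (by omega)) ((q2 _).2 (by omega))
    · omega
    all_goals
      rintro (hm | ⟨u, hu, hadj⟩)
      · exact hno' _ hm (by omega)
      · have := hno' u hu
        have := hadj.symm
        simp only [q2, q3, q4] at this
        omega
  have := (Finset.card_le_card hsub).trans Finset.card_image_le
  simpa using this

/-- **Sharpness of the bound `(n − n₂)/3`.** For every `t ≥ 2` there is a mop `G` of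
order `n = 5t` with exactly `n₂ = 2t` vertices of degree `2` such that
`ι₁(G) = t = (n − n₂)/3`. -/
theorem mop_iota1_sharp_n_sub_n2_div_three (t : ℕ) (ht : 2 ≤ t) :
    ∃ (G : SimpleGraph ℕ) (V : Finset ℕ),
      IsMop G V ∧ V.card = 5 * t ∧ numDeg2 G V = 2 * t ∧ iota1 G V = t ∧
      (iota1 G V : ℚ) = ((V.card : ℚ) - (numDeg2 G V : ℚ)) / 3 := by
  obtain ⟨s, rfl⟩ : ∃ s, t = s + 1 := ⟨t - 1, by omega⟩
  obtain ⟨G, C, hG, -, hB⟩ := exists_block s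
  refine ⟨G, Finset.range (5 * (s + 1)), ⟨C, hG⟩, Finset.card_range _, block_numDeg2 hB,
    block_iota hB, ?_⟩
  rw [block_numDeg2 hB, block_iota hB, Finset.card_range]
  push_cast
  ring
end

section
/- For every integer t ≥ 1 there exists a maximal outerplanar graph G of order n = 15t having exactly n₂ = 5t vertices of degree 2 (so n/5 < n₂ < 2n/5) such that the K_{1,2}-isolation number of G satisfies ι₁(G) = 3t = n/5; hence the bound ι₁(G) ≤ n/5 is sharp even in the range n/5 < n₂ < 2n/5 where it improves on the bounds (n + n₂)/6 and (n − n₂)/3. -/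
open SimpleGraph

/-- `x` is one of the (at most two) earlier neighbours of `y`. -/
def LoNbr (y x : ℕ) : Prop :=
  (y % 5 = 0 ∧ 5 ≤ y ∧ (x + 4 = y ∨ x = 0)) ∨
  (y % 5 = 1 ∧ (x + 1 = y ∨ x = 0)) ∨
  (y % 5 = 2 ∧ (x + 2 = y ∨ x + 1 = y)) ∨
  (y % 5 = 3 ∧ y / 5 % 3 ≠ 2 ∧ (x + 2 = y ∨ x + 1 = y)) ∨
  (y % 5 = 3 ∧ y / 5 % 3 = 2 ∧ (x + 3 = y ∨ x + 1 = y)) ∨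
  (y % 5 = 4 ∧ y / 5 % 3 ≠ 2 ∧ (x + 4 = y ∨ x + 2 = y)) ∨
  (y % 5 = 4 ∧ y / 5 % 3 = 2 ∧ (x + 4 = y ∨ x + 1 = y))

theorem LoNbr.lt {y x : ℕ} (h : LoNbr y x) : x < y := by
  unfold LoNbr at h; omega

theorem lo0 (i x : ℕ) : LoNbr (5 * i) x ↔ 1 ≤ i ∧ (x + 4 = 5 * i ∨ x = 0) := by
  unfold LoNbr; omega

theorem lo1 (i x : ℕ) : LoNbr (5 * i + 1) x ↔ x = 5 * i ∨ x = 0 := by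
  unfold LoNbr; omega

theorem lo2 (i x : ℕ) : LoNbr (5 * i + 2) x ↔ x = 5 * i ∨ x = 5 * i + 1 := by
  unfold LoNbr; omega

theorem lo3 (i x : ℕ) : LoNbr (5 * i + 3) x ↔
    x = 5 * i + 2 ∨ (i % 3 = 2 ∧ x = 5 * i) ∨ (i % 3 ≠ 2 ∧ x = 5 * i + 1) := by
  have e : (5 * i + 3) / 5 = i := by omega
  unfold LoNbr; rw [e]; omega

theorem lo4 (i x : ℕ) : LoNbr (5 * i + 4) x ↔
    x = 5 * i ∨ (i % 3 = 2 ∧ x = 5 * i + 3) ∨ (i % 3 ≠ 2 ∧ x = 5 * i + 2) := by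
  have e : (5 * i + 4) / 5 = i := by omega
  unfold LoNbr; rw [e]; omega

theorem hi4 (i x : ℕ) : LoNbr x (5 * i + 4) ↔ False := by
  rw [iff_false]; unfold LoNbr; omega

theorem hi3 (i x : ℕ) : LoNbr x (5 * i + 3) ↔ i % 3 = 2 ∧ x = 5 * i + 4 := by
  constructor
  · intro h
    have hx : x = 5 * i + 4 := by unfold LoNbr at h; omega
    subst hx
    rw [lo4] at h
    omega
  · rintro ⟨h, rfl⟩
    rw [lo4]; omega

/-- The graph on the first `n` vertices. -/
def gr (n : ℕ) : SimpleGraph ℕ where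
  Adj x y := x < n ∧ y < n ∧ (LoNbr x y ∨ LoNbr y x)
  symm := ⟨fun _ _ h => ⟨h.2.1, h.1, h.2.2.symm⟩⟩
  loopless := ⟨fun x h => by
    rcases h.2.2 with h | h <;> exact absurd h.lt (lt_irrefl _)⟩

theorem gr_adj {n x y : ℕ} :
    (gr n).Adj x y ↔ x < n ∧ y < n ∧ (LoNbr x y ∨ LoNbr y x) := Iff.rfl

theorem grow_step {n : ℕ} {C : Finset (Sym2 ℕ)} (p q : ℕ)
    (hG : IsMopCycle (gr n) (Finset.range n) C) (hC : s(p, q) ∈ C)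
    (hlo : ∀ x, LoNbr n x ↔ x = p ∨ x = q) :
    IsMopCycle (gr (n + 1)) (Finset.range (n + 1))
      (insert s(p, n) (insert s(q, n) (C.erase s(p, q)))) := by
  have hp : p < n := ((hlo p).2 (Or.inl rfl)).lt
  have hq : q < n := ((hlo q).2 (Or.inr rfl)).lt
  have h := IsMopCycle.grow (gr n) (Finset.range n) C p q n hG hC (by simp)
  have e : SimpleGraph.fromEdgeSet (insert s(p, n) (insert s(q, n) (gr n).edgeSet))
      = gr (n + 1) := by
    ext x y
    simp only [SimpleGraph.fromEdgeSet_adj, Set.mem_insert_iff, SimpleGraph.mem_edgeSet,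
      gr_adj, Sym2.eq_iff]
    have hx := hlo x
    have hy := hlo y
    have l1 : LoNbr x y → y < x := LoNbr.lt
    have l2 : LoNbr y x → x < y := LoNbr.lt
    rcases lt_trichotomy x n with h1 | h1 | h1 <;> rcases lt_trichotomy y n with h2 | h2 | h2 <;>
      first
      | (subst h1; grind)
      | (subst h2; grind)
      | grind
  rw [e, ← Finset.range_add_one] at h
  exact h

theorem base_three : IsMopCycle (gr 3) (Finset.range 3) {s(0, 1), s(1, 2), s(0, 2)} := by
  have h := IsMopCycle.triangle 0 1 2 (by decide) (by decide) (by decide)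
  have e : SimpleGraph.fromEdgeSet {s(0, 1), s(1, 2), s(0, 2)} = gr 3 := by
    ext x y
    simp only [SimpleGraph.fromEdgeSet_adj, Set.mem_insert_iff, Set.mem_singleton_iff,
      gr_adj, Sym2.eq_iff]
    rcases lt_or_ge x 3 with hx | hx
    · rcases lt_or_ge y 3 with hy | hy
      · interval_cases x <;> interval_cases y <;> simp [LoNbr]
      · omega
    · omega
  rw [e] at h
  exact h

theorem finish_block (i : ℕ) (C : Finset (Sym2 ℕ))
    (hG : IsMopCycle (gr (5 * i + 3)) (Finset.range (5 * i + 3)) C)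
    (h0 : s(5 * i + 1, 0) ∈ C)
    (h1 : s(5 * i, 5 * i + 2) ∈ C) (h2 : s(5 * i + 1, 5 * i + 2) ∈ C) :
    ∃ C, IsMopCycle (gr (5 * (i + 1))) (Finset.range (5 * (i + 1))) C ∧
      s(5 * i + 1, 0) ∈ C := by
  by_cases hi : i % 3 = 2
  · have s1 := grow_step (5 * i) (5 * i + 2) hG h1 (by intro x; unfold LoNbr; omega)
    have s2 := grow_step (5 * i) (5 * i + 3) s1 (by simp) (by intro x; unfold LoNbr; omega)
    refine ⟨_, s2, ?_⟩
    simp only [Finset.mem_insert, Finset.mem_erase, h0, Sym2.eq_iff, ne_eq]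
    simp
  · have s1 := grow_step (5 * i + 1) (5 * i + 2) hG h2 (by intro x; unfold LoNbr; omega)
    have s2 := grow_step (5 * i) (5 * i + 2) s1
      (by simp only [Finset.mem_insert, Finset.mem_erase, h1, Sym2.eq_iff, ne_eq]; simp)
      (by intro x; unfold LoNbr; omega)
    refine ⟨_, s2, ?_⟩
    simp only [Finset.mem_insert, Finset.mem_erase, h0, Sym2.eq_iff, ne_eq]
    simp

theorem gr_mop (i : ℕ) :
    ∃ C, IsMopCycle (gr (5 * (i + 1))) (Finset.range (5 * (i + 1))) C ∧
      s(5 * i + 1, 0) ∈ C := by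
  induction i with
  | zero =>
    exact finish_block 0 _ base_three (by decide) (by decide) (by decide)
  | succ i ih =>
    obtain ⟨C, hC, h0⟩ := ih
    have s1 := grow_step (5 * i + 1) 0 hC h0 (by intro x; unfold LoNbr; omega)
    have s2 := grow_step (5 * (i + 1)) 0 s1 (by simp [Sym2.eq_swap])
      (by intro x; unfold LoNbr; omega)
    have s3 := grow_step (5 * (i + 1)) (5 * (i + 1) + 1) s2 (by simp)
      (by intro x; unfold LoNbr; omega)
    refine finish_block (i + 1) _ s3 ?_ ?_ ?_
    · simp only [Finset.mem_insert, Finset.mem_erase, Sym2.eq_iff, ne_eq]; simp; try omega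
    · simp
    · simp

/-- The vertices of degree two. -/
def IsTwo (v : ℕ) : Prop := v % 5 = 4 ∨ (v % 5 = 3 ∧ v / 5 % 3 ≠ 2)

instance : DecidablePred IsTwo := fun v => by unfold IsTwo; infer_instance

theorem three_le {n v a b c : ℕ} (hab : a ≠ b) (hac : a ≠ c) (hbc : b ≠ c)
    (h1 : (gr n).Adj v a) (h2 : (gr n).Adj v b) (h3 : (gr n).Adj v c) :
    degOf (gr n) v ≠ 2 := by
  have hfin : ((gr n).neighborSet v).Finite :=
    (Set.finite_lt_nat n).subset fun x hx => hx.2.1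
  have hsub : (({a, b, c} : Finset ℕ) : Set ℕ) ⊆ (gr n).neighborSet v := by
    intro x hx
    simp only [Finset.coe_insert, Finset.coe_singleton, Set.mem_insert_iff,
      Set.mem_singleton_iff] at hx
    rcases hx with rfl | rfl | rfl <;> assumption
  have := Set.ncard_le_ncard hsub hfin
  rw [Set.ncard_coe_finset, Finset.card_eq_three.2 ⟨a, b, c, hab, hac, hbc, rfl⟩] at this
  unfold degOf
  omega

theorem two_eq {n v a b : ℕ} (hab : a ≠ b)
    (h : ∀ x, (gr n).Adj v x ↔ x = a ∨ x = b) : degOf (gr n) v = 2 := by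
  have : (gr n).neighborSet v = {a, b} := by
    ext x; simpa using h x
  unfold degOf
  rw [this, Set.ncard_pair hab]

set_option linter.unusedSimpArgs false

theorem deg_iff (m v : ℕ) (hv : v < 5 * m) : degOf (gr (5 * m)) v = 2 ↔ IsTwo v := by
  obtain ⟨i, r, hr, rfl⟩ : ∃ i r, r < 5 ∧ v = 5 * i + r :=
    ⟨v / 5, v % 5, Nat.mod_lt _ (by decide), by omega⟩
  have him : i < m := by omega
  by_cases hi : i % 3 = 2
  · interval_cases r <;> try rw [Nat.add_zero] at *
    · (refine iff_of_false (three_le (a := 5 * i + 1) (b := 5 * i + 2) (c := 5 * i + 4)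
        ?_ ?_ ?_ ?_ ?_ ?_) ?_ <;> try simp only [gr_adj, lo0, lo1, lo2, lo3, lo4, IsTwo, true_or, or_true, or_false, and_true,
          true_and]) <;> omega
    · (refine iff_of_false (three_le (a := 5 * i) (b := 5 * i + 2) (c := 0)
        ?_ ?_ ?_ ?_ ?_ ?_) ?_ <;> try simp only [gr_adj, lo0, lo1, lo2, lo3, lo4, IsTwo, true_or, or_true, or_false, and_true,
          true_and]) <;> omega
    · (refine iff_of_false (three_le (a := 5 * i) (b := 5 * i + 1) (c := 5 * i + 3)
        ?_ ?_ ?_ ?_ ?_ ?_) ?_ <;> try simp only [gr_adj, lo0, lo1, lo2, lo3, lo4, IsTwo, true_or, or_true, or_false, and_true,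
          true_and]) <;> omega
    · (refine iff_of_false (three_le (a := 5 * i) (b := 5 * i + 2) (c := 5 * i + 4)
        ?_ ?_ ?_ ?_ ?_ ?_) ?_ <;> try simp only [gr_adj, lo0, lo1, lo2, lo3, lo4, IsTwo, true_or, or_true, or_false, and_true,
          true_and]) <;> omega
    · (refine iff_of_true (two_eq (a := 5 * i) (b := 5 * i + 3) ?_ ?_) ?_ <;>
        try simp only [gr_adj, lo0, lo1, lo2, lo3, lo4, hi3, hi4, IsTwo, true_or, or_true, or_false, and_true,
          true_and]) <;> omega
  · interval_cases r <;> try rw [Nat.add_zero] at *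
    · (refine iff_of_false (three_le (a := 5 * i + 1) (b := 5 * i + 2) (c := 5 * i + 4)
        ?_ ?_ ?_ ?_ ?_ ?_) ?_ <;> try simp only [gr_adj, lo0, lo1, lo2, lo3, lo4, IsTwo, true_or, or_true, or_false, and_true,
          true_and]) <;> omega
    · (refine iff_of_false (three_le (a := 5 * i) (b := 5 * i + 2) (c := 5 * i + 3)
        ?_ ?_ ?_ ?_ ?_ ?_) ?_ <;> try simp only [gr_adj, lo0, lo1, lo2, lo3, lo4, IsTwo, true_or, or_true, or_false, and_true,
          true_and]) <;> omega
    · (refine iff_of_false (three_le (a := 5 * i) (b := 5 * i + 1) (c := 5 * i + 3)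
        ?_ ?_ ?_ ?_ ?_ ?_) ?_ <;> try simp only [gr_adj, lo0, lo1, lo2, lo3, lo4, IsTwo, true_or, or_true, or_false, and_true,
          true_and]) <;> omega
    · (refine iff_of_true (two_eq (a := 5 * i + 1) (b := 5 * i + 2) ?_ ?_) ?_ <;>
        try simp only [gr_adj, lo0, lo1, lo2, lo3, lo4, hi3, hi4, IsTwo, true_or, or_true, or_false, and_true,
          true_and]) <;> omega
    · (refine iff_of_true (two_eq (a := 5 * i) (b := 5 * i + 2) ?_ ?_) ?_ <;>
        try simp only [gr_adj, lo0, lo1, lo2, lo3, lo4, hi3, hi4, IsTwo, true_or, or_true, or_false, and_true,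
          true_and]) <;> omega

theorem count_two (t : ℕ) : Nat.count IsTwo (15 * t) = 5 * t := by
  induction t with
  | zero => simp
  | succ t ih =>
    have e : (fun k => IsTwo (15 * t + k)) = IsTwo := by
      funext k; unfold IsTwo; apply propext; omega
    have h15 : Nat.count IsTwo 15 = 5 := by decide
    rw [Nat.mul_succ, Nat.count_add, ih]
    simp only [e, h15]
    omega

theorem gr_numDeg2 (t : ℕ) :
    numDeg2 (gr (5 * (3 * t))) (Finset.range (5 * (3 * t))) = 5 * t := by
  have e : {v ∈ ((Finset.range (5 * (3 * t)) : Finset ℕ) : Set ℕ) |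
      degOf (gr (5 * (3 * t))) v = 2} =
      (((Finset.range (5 * (3 * t))).filter IsTwo : Finset ℕ) : Set ℕ) := by
    ext v
    simp only [Finset.coe_filter, Set.mem_ofPred_eq, Finset.mem_coe, Finset.mem_range]
    exact and_congr_right fun hv => deg_iff _ v hv
  unfold numDeg2
  rw [e, Set.ncard_coe_finset, ← Nat.count_eq_card_filter_range,
    show 5 * (3 * t) = 15 * t by ring, count_two]

theorem lower_aux {m : ℕ} {S : Finset ℕ}
    (hS : IsIsolating12 (gr (5 * m)) (Finset.range (5 * m)) S) : m ≤ S.card := by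
  have hsub : Finset.range m ⊆ S.image (· / 5) := by
    intro i hi
    rw [Finset.mem_range] at hi
    by_contra hn
    have hS' : ∀ s ∈ S, s / 5 ≠ i := fun s hs h => hn (Finset.mem_image.2 ⟨s, hs, h⟩)
    have key : ∀ x, x / 5 = i → 2 ≤ x % 5 → x ∉ closedNbhd (gr (5 * m)) S := by
      rintro x hx hx2 (h | ⟨u, hu, h⟩)
      · exact hS' x h hx
      · apply hS' u hu
        simp only [gr_adj, LoNbr] at h
        omega
    have k2 := key (5 * i + 2) (by omega) (by omega)
    have k3 := key (5 * i + 3) (by omega) (by omega)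
    have k4 := key (5 * i + 4) (by omega) (by omega)
    have m2 : 5 * i + 2 ∈ Finset.range (5 * m) := by simp; omega
    have m3 : 5 * i + 3 ∈ Finset.range (5 * m) := by simp; omega
    have m4 : 5 * i + 4 ∈ Finset.range (5 * m) := by simp; omega
    by_cases h3 : i % 3 = 2
    · have := hS.2 _ _ _ m3 m2 m4 k3 k2 k4 (by simp only [gr_adj, lo2, lo3, lo4, true_or, or_true, or_false, and_true,
          true_and] <;> omega)
        (by simp only [gr_adj, lo2, lo3, lo4, true_or, or_true, or_false, and_true,
          true_and] <;> omega)
      omega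
    · have := hS.2 _ _ _ m2 m3 m4 k2 k3 k4 (by simp only [gr_adj, lo2, lo3, lo4, true_or, or_true, or_false, and_true,
          true_and] <;> omega)
        (by simp only [gr_adj, lo2, lo3, lo4, true_or, or_true, or_false, and_true,
          true_and] <;> omega)
      omega
  have := Finset.card_le_card hsub
  rw [Finset.card_range] at this
  exact this.trans Finset.card_image_le

/-- The vertex dominating the whole `i`-th gadget. -/
def apex (i : ℕ) : ℕ := if i % 3 = 2 then 5 * i else 5 * i + 2

theorem upper_aux (m : ℕ) :
    ∃ S, IsIsolating12 (gr (5 * m)) (Finset.range (5 * m)) S ∧ S.card = m := by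
  refine ⟨(Finset.range m).image apex, ⟨?_, ?_⟩, ?_⟩
  · intro x hx
    obtain ⟨i, hi, rfl⟩ := Finset.mem_image.1 hx
    rw [Finset.mem_range] at hi ⊢
    unfold apex; split <;> omega
  · intro x y z hx _ _ hx' 
    exfalso
    apply hx'
    rw [Finset.mem_range] at hx
    have hm : apex (x / 5) ∈ (Finset.range m).image apex :=
      Finset.mem_image_of_mem _ (by rw [Finset.mem_range]; omega)
    obtain ⟨i, r, hr, rfl⟩ : ∃ i r, r < 5 ∧ x = 5 * i + r :=
      ⟨x / 5, x % 5, Nat.mod_lt _ (by decide), by omega⟩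
    have e : (5 * i + r) / 5 = i := by omega
    rw [e] at hm
    by_cases he : apex i = 5 * i + r
    · left; rw [← he]; exact hm
    · right
      refine ⟨_, hm, ?_⟩
      clear hm hx' e
      unfold apex at he ⊢
      by_cases h3 : i % 3 = 2
      · rw [if_pos h3] at he ⊢
        interval_cases r <;> simp only [gr_adj, lo0, lo1, lo2, lo3, lo4, Nat.add_zero, true_or, or_true, or_false, and_true,
          true_and] <;> omega
      · rw [if_neg h3] at he ⊢
        interval_cases r <;> simp only [gr_adj, lo0, lo1, lo2, lo3, lo4, Nat.add_zero, true_or, or_true, or_false, and_true,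
          true_and] <;> omega
  · rw [Finset.card_image_of_injective, Finset.card_range]
    intro i j h
    unfold apex at h
    split at h <;> split at h <;> omega

theorem gr_iota1 (m : ℕ) : iota1 (gr (5 * m)) (Finset.range (5 * m)) = m := by
  unfold iota1
  apply le_antisymm
  · exact Nat.sInf_le (upper_aux m)
  · refine le_csInf ⟨m, upper_aux m⟩ ?_
    rintro k ⟨S, hS, rfl⟩
    exact lower_aux hS

/-- **Sharpness of the bound `n/5` in the range `n/5 < n₂ < 2n/5`.** For every
`t ≥ 1` there is a mop `G` of order `n = 15t` with exactly `n₂ = 5t` vertices of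
degree `2` (so `n/5 < n₂ < 2n/5`) such that `ι₁(G) = 3t = n/5`. -/
theorem mop_iota1_sharp_middle_range (t : ℕ) (ht : 1 ≤ t) :
    ∃ (G : SimpleGraph ℕ) (V : Finset ℕ),
      IsMop G V ∧ V.card = 15 * t ∧ numDeg2 G V = 5 * t ∧
      (V.card : ℚ) / 5 < (numDeg2 G V : ℚ) ∧
      (numDeg2 G V : ℚ) < 2 * (V.card : ℚ) / 5 ∧
      iota1 G V = 3 * t ∧ (iota1 G V : ℚ) = (V.card : ℚ) / 5 := by
  have hmop : IsMop (gr (5 * (3 * t))) (Finset.range (5 * (3 * t))) := by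
    obtain ⟨C, hC, -⟩ := gr_mop (3 * t - 1)
    rw [show 3 * t - 1 + 1 = 3 * t by omega] at hC
    exact ⟨C, hC⟩
  have hpos : (1 : ℚ) ≤ t := by exact_mod_cast ht
  refine ⟨gr (5 * (3 * t)), Finset.range (5 * (3 * t)), hmop, ?_, gr_numDeg2 t, ?_, ?_,
    gr_iota1 _, ?_⟩
  · rw [Finset.card_range]; ring
  · rw [gr_numDeg2, Finset.card_range]; push_cast; linarith
  · rw [gr_numDeg2, Finset.card_range]; push_cast; linarith
  · rw [gr_iota1, Finset.card_range]; push_cast; ring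
end

section
/- Every maximal outerplanar graph has a unique Hamiltonian cycle; that is, any two Hamiltonian cycles of a maximal outerplanar graph consist of the same set of edges. -/
open SimpleGraph

/-- The pair `x, y` separates `G` (with vertex set `V`). -/
def MopSep (G : SimpleGraph ℕ) (V : Finset ℕ) (x y : ℕ) : Prop :=
  ∃ S : Set ℕ, (∃ s ∈ V, s ∈ S ∧ s ≠ x ∧ s ≠ y) ∧ (∃ t ∈ V, t ∉ S ∧ t ≠ x ∧ t ≠ y) ∧
    ∀ a b, G.Adj a b → a ≠ x → a ≠ y → b ≠ x → b ≠ y → (a ∈ S ↔ b ∈ S)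

theorem MopSep.symm {G : SimpleGraph ℕ} {V : Finset ℕ} {x y : ℕ} (h : MopSep G V x y) :
    MopSep G V y x := by
  obtain ⟨S, ⟨s, h1, h2, h3, h4⟩, ⟨t, h5, h6, h7, h8⟩, h9⟩ := h
  exact ⟨S, ⟨s, h1, h2, h4, h3⟩, ⟨t, h5, h6, h8, h7⟩, fun a b hab k1 k2 k3 k4 =>
    h9 a b hab k2 k1 k4 k3⟩

theorem mop_invariants {G : SimpleGraph ℕ} {V : Finset ℕ} {C : Finset (Sym2 ℕ)}
    (h : IsMopCycle G V C) :
    (∀ a b, G.Adj a b → a ∈ V) ∧ (∀ a b, s(a, b) ∈ C → G.Adj a b) ∧ C.card ≤ V.card ∧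
      3 ≤ V.card ∧ ∀ x y, G.Adj x y → s(x, y) ∉ C → MopSep G V x y := by
  induction h with
  | triangle a b c hab hac hbc =>
    have hV : ({a, b, c} : Finset ℕ).card = 3 := Finset.card_eq_three.2 ⟨a, b, c, hab, hac, hbc, rfl⟩
    refine ⟨?_, ?_, ?_, hV.ge, ?_⟩
    · intro x y h
      simp only [fromEdgeSet_adj, Set.mem_insert_iff, Set.mem_singleton_iff, Sym2.eq_iff] at h
      simp only [Finset.mem_insert, Finset.mem_singleton]
      grind
    · intro x y h
      simp only [fromEdgeSet_adj, Set.mem_insert_iff, Set.mem_singleton_iff, Sym2.eq_iff]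
      simp only [Finset.mem_insert, Finset.mem_singleton, Sym2.eq_iff] at h
      grind
    · rw [hV]; exact Finset.card_le_three
    · intro x y h hn
      simp only [fromEdgeSet_adj, Set.mem_insert_iff, Set.mem_singleton_iff] at h
      simp only [Finset.mem_insert, Finset.mem_singleton] at hn
      exact absurd h.1 hn
  | grow G V C u v w hG huv hw ih =>
    obtain ⟨i1, i2, i3, i4, i5⟩ := ih
    have auv := i2 u v huv
    have hu := i1 u v auv
    have hv := i1 v u auv.symm
    have hne := auv.ne
    have hadj : ∀ a b, (SimpleGraph.fromEdgeSet
        (insert s(u, w) (insert s(v, w) G.edgeSet))).Adj a b ↔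
        (G.Adj a b ∨ (a = u ∧ b = w) ∨ (a = w ∧ b = u) ∨ (a = v ∧ b = w) ∨ (a = w ∧ b = v)) := by
      intro a b
      simp only [fromEdgeSet_adj, Set.mem_insert_iff, Sym2.eq_iff, mem_edgeSet]
      have := @Adj.ne _ G a b
      grind
    refine ⟨?_, ?_, ?_, ?_, ?_⟩
    · intro a b h
      rw [hadj] at h
      have := i1 a b
      grind
    · intro a b h
      rw [hadj]
      simp only [Finset.mem_insert, Finset.mem_erase, Sym2.eq_iff] at h
      have := i2 a b
      grind
    · rw [Finset.card_insert_of_notMem hw]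
      have h1 := Finset.card_insert_le s(u, w) (insert s(v, w) (C.erase s(u, v)))
      have h2 := Finset.card_insert_le s(v, w) (C.erase s(u, v))
      have h3 := Finset.card_erase_add_one huv
      omega
    · rw [Finset.card_insert_of_notMem hw]; omega
    · intro x y h hn
      rw [hadj] at h
      simp only [Finset.mem_insert, Finset.mem_erase, not_or, not_and] at hn
      obtain ⟨n1, n2, n3⟩ := hn
      have hxy : G.Adj x y := by
        simp only [Sym2.eq_iff] at n1 n2
        grind
      have hx := i1 x y hxy
      have hy := i1 y x hxy.symm
      by_cases he : s(x, y) = s(u, v)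
      · have hlt : ({x, y} : Finset ℕ).card < V.card :=
          lt_of_le_of_lt Finset.card_le_two (by omega)
        obtain ⟨t, ht, ht'⟩ := Finset.exists_mem_notMem_of_card_lt_card hlt
        refine ⟨{w}, ⟨w, by simp, rfl, ?_, ?_⟩, ⟨t, by simp [ht], ?_, ?_, ?_⟩, ?_⟩
        · grind
        · grind
        · simp; grind
        · grind
        · grind
        · intro a b hab
          rw [hadj] at hab
          rw [Sym2.eq_iff] at he
          have := i1 a b
          have := i1 b a
          have := G.adj_comm a b
          simp only [Set.mem_singleton_iff]
          grind
      · obtain ⟨S, ⟨s, s1, s2, s3, s4⟩, ⟨t, t1, t2, t3, t4⟩, hS⟩ := i5 x y hxy (n3 he)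
        obtain ⟨r, hr, hrx, hry⟩ : ∃ r, (r = u ∨ r = v) ∧ r ≠ x ∧ r ≠ y := by
          by_contra hcon
          push Not at hcon
          have := hcon u (Or.inl rfl)
          have := hcon v (Or.inr rfl)
          rw [Sym2.eq_iff] at he
          grind
        refine ⟨{a | a ≠ w ∧ a ∈ S ∨ a = w ∧ r ∈ S}, ⟨s, by simp [s1], ?_, s3, s4⟩,
          ⟨t, by simp [t1], ?_, t3, t4⟩, ?_⟩
        · simp only [Set.mem_setOf_eq]; grind
        · simp only [Set.mem_setOf_eq]; grind
        · intro a b hab ha1 ha2 hb1 hb2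
          rw [hadj] at hab
          have k1 := i1 a b
          have k2 := i1 b a
          have k3 := G.adj_comm a b
          have k4 := hS u v auv
          have k5 := hS a b
          simp only [Set.mem_setOf_eq]
          grind

theorem mop_path_side {G : SimpleGraph ℕ} {x y : ℕ} {S : Set ℕ}
    (hS : ∀ a b, G.Adj a b → a ≠ x → a ≠ y → b ≠ x → b ≠ y → (a ∈ S ↔ b ∈ S)) :
    ∀ {z x' : ℕ} (r : G.Walk z x'), x' = x → r.IsPath → y ∉ r.support →
      ∀ a ∈ r.support, a ≠ x → (a ∈ S ↔ z ∈ S) := by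
  intro z x' r
  induction r with
  | nil => intro h _ _ a ha hax; simp at ha; subst ha; rfl
  | @cons z z' w hadj r ih =>
    intro h hp hy a ha hax
    rw [Walk.cons_isPath_iff] at hp
    rw [Walk.support_cons, List.mem_cons] at hy ha
    push Not at hy
    rcases ha with rfl | ha
    · rfl
    · rw [ih h hp.1 hy.2 a ha hax]
      have hzx : z ≠ x := by
        rintro rfl; exact hp.2 (h ▸ r.end_mem_support)
      by_cases hz' : z' = x
      · exfalso
        subst hz'
        subst h
        have hnil := Walk.nil_iff_support_eq.1 (Walk.isPath_iff_nil.1 hp.1)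
        rw [hnil] at ha
        simp at ha
        exact hax ha
      · exact (hS z z' hadj hzx (Ne.symm hy.1) hz'
          (fun e => hy.2 (e ▸ r.start_mem_support))).symm

theorem mop_no_chord {G : SimpleGraph ℕ} {V : Finset ℕ} {a x y : ℕ} (p : G.Walk a a)
    (hp : p.IsCycle) (hpV : p.support.toFinset = V) (hd : ∃ d ∈ p.darts, d.fst = x ∧ d.snd = y)
    (hsep : MopSep G V x y) : False := by
  obtain ⟨S, ⟨s, s1, s2, s3, s4⟩, ⟨t, t1, t2, t3, t4⟩, hS⟩ := hsep
  obtain ⟨d, hd, hdx, hdy⟩ := hd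
  subst hpV
  have hx : x ∈ p.support := hdx ▸ p.dart_fst_mem_support_of_mem_darts hd
  have hcyc : (p.rotate x hx).IsCycle := (Walk.isCycle_rotate hx).2 hp
  have hd' : d ∈ (p.rotate x hx).darts := (p.rotate_darts x hx).mem_iff.2 hd
  have hsup : ∀ z, z ∈ (p.rotate x hx).support ↔ z ∈ p.support :=
    fun z => p.mem_support_rotate_iff x hx
  rw [List.mem_toFinset, ← hsup] at s1 t1
  generalize p.rotate x hx = p' at *
  cases p' with
  | nil => simp at hd'
  | @cons _ z _ h r =>
    rw [Walk.cons_isCycle_iff] at hcyc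
    have hz : z = y := by
      rw [Walk.darts_cons, List.mem_cons] at hd'
      rcases hd' with rfl | hd'
      · exact hdy
      · exfalso
        have hn := hcyc.1.support_nodup
        rw [← Walk.map_fst_darts_append, List.nodup_append] at hn
        exact hn.2.2 x (List.mem_map.2 ⟨d, hd', hdx⟩) x (by simp) rfl
    subst hz
    have hr := hcyc.1
    rw [Walk.support_cons, List.mem_cons] at s1 t1
    cases r with
    | nil => simp at h
    | @cons _ z' _ h' r' =>
      rw [Walk.cons_isPath_iff] at hr
      rw [Walk.support_cons, List.mem_cons] at s1 t1
      have k1 := mop_path_side hS r' rfl hr.1 hr.2 s (by tauto) s3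
      have k2 := mop_path_side hS r' rfl hr.1 hr.2 t (by tauto) t3
      tauto

theorem mop_edges_eq (G : SimpleGraph ℕ) (V : Finset ℕ)
    (C : Finset (Sym2 ℕ)) (h : IsMopCycle G V C) (a : ℕ)
    (p : G.Walk a a) (hp : p.IsCycle)
    (hpV : p.support.toFinset = V) : p.edges.toFinset = C := by
  obtain ⟨i1, i2, i3, i4, i5⟩ := mop_invariants h
  apply Finset.eq_of_subset_of_card_le
  · intro e he
    rw [List.mem_toFinset] at he
    by_contra hC
    obtain ⟨d, hd, rfl⟩ := List.mem_map.1 he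
    exact mop_no_chord p hp hpV ⟨d, hd, rfl, rfl⟩ (i5 d.fst d.snd d.adj hC)
  · rw [List.toFinset_card_of_nodup hp.edges_nodup, Walk.length_edges]
    refine i3.trans ?_
    have : V = p.support.tail.toFinset := by
      rw [← hpV]
      ext z
      rw [List.mem_toFinset, List.mem_toFinset, Walk.mem_support_iff]
      constructor
      · rintro (rfl | h)
        · exact Walk.end_mem_tail_support hp.not_nil
        · exact h
      · exact Or.inr
    rw [this]
    refine (List.toFinset_card_le _).trans ?_
    simp

/-- **Uniqueness of the Hamiltonian cycle of a mop.** Any two Hamiltonian cycles of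
a maximal outerplanar graph (cycles whose support is the whole vertex set) consist
of the same set of edges. -/
theorem mop_unique_hamiltonian_cycle (G : SimpleGraph ℕ) (V : Finset ℕ)
    (C : Finset (Sym2 ℕ)) (h : IsMopCycle G V C) (a b : ℕ)
    (p : G.Walk a a) (q : G.Walk b b) (hp : p.IsCycle) (hq : q.IsCycle)
    (hpV : p.support.toFinset = V) (hqV : q.support.toFinset = V) :
    p.edges.toFinset = q.edges.toFinset := by
  rw [mop_edges_eq G V C h a p hp hpV, mop_edges_eq G V C h b q hq hqV]
end
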